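/- Let n ≥ 1 and let E ⊂ ℝ^{n+1} be an n-dimensional uniformly rectifiable set. Then E ∈ BP²(LG): there exist a constant θ > 0 and a collection 𝒮 of n-dimensional ADR sets, each of which has big pieces of Lipschitz graphs, with uniform control of all ADR, big-pieces and Lipschitz constants (depending only on n and the UR character of E), such that for every x ∈ E and r ∈ (0, diam E) there is S ∈ 𝒮 with H^n(B(x,r) ∩ E ∩ S) ≥ θ r^n. -/

import Mathlib

open Metric MeasureTheory Set
open scoped NNReal ENNReal

noncomputable section

/-- `ℝ^{n+1}` -/
abbrev Euc (n : ℕ) : Type := EuclideanSpace ℝ (Fin (n + 1))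

/-- The distance between two subsets of `ℝ^{n+1}`. -/
def sDist {n : ℕ} (A B : Set (Euc n)) : ℝ := sInf (Set.image2 dist A B)

/-- `E ⊆ ℝ^{n+1}` is an `n`-dimensional Ahlfors-David regular set with constant `C`. -/
def IsADR (n : ℕ) (E : Set (Euc n)) (C : ℝ) : Prop :=
  IsClosed E ∧ 1 ≤ C ∧ ∀ x ∈ E, ∀ r : ℝ, 0 < r → ENNReal.ofReal r < EMetric.diam E →
    ENNReal.ofReal (C⁻¹ * r ^ n) ≤ μH[(n : ℝ)] (E ∩ ball x r) ∧
      μH[(n : ℝ)] (E ∩ ball x r) ≤ ENNReal.ofReal (C * r ^ n)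

/-- `E ⊆ ℝ^{n+1}` is `n`-dimensional uniformly rectifiable, with UR character
`(θ, M₀)` together with the ADR constant `C`. -/
def IsUR (n : ℕ) (E : Set (Euc n)) (C θ : ℝ) (M₀ : ℝ≥0) : Prop :=
  IsADR n E C ∧ 0 < θ ∧ ∀ x ∈ E, ∀ r : ℝ, 0 < r → ENNReal.ofReal r < EMetric.diam E →
    ∃ ρ : EuclideanSpace ℝ (Fin n) → Euc n, LipschitzWith M₀ ρ ∧
      ENNReal.ofReal (θ * r ^ n) ≤ μH[(n : ℝ)] (E ∩ ball x r ∩ ρ '' ball 0 r)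

/-- `Γ ⊆ ℝ^{n+1}` is a Lipschitz graph with Lipschitz constant at most `M`:
there are an `n`-plane `P` and a Lipschitz map `ρ` from `P` into the line `Pᗮ`
perpendicular to `P` with `Γ = {y + ρ(y) : y ∈ P}`. -/
def IsLipschitzGraph (n : ℕ) (M : ℝ≥0) (Γ : Set (Euc n)) : Prop :=
  ∃ P : Submodule ℝ (Euc n), Module.finrank ℝ P = n ∧
    ∃ ρ : P → Pᗮ, LipschitzWith M ρ ∧
      Γ = {y : Euc n | ∃ p : P, y = (p : Euc n) + ((ρ p : Pᗮ) : Euc n)}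

/-- `S` has big pieces of Lipschitz graphs, with big-pieces constant `θ'` and
Lipschitz constant `M`. -/
def HasBPLG (n : ℕ) (S : Set (Euc n)) (θ' : ℝ) (M : ℝ≥0) : Prop :=
  ∀ x ∈ S, ∀ r : ℝ, 0 < r → ENNReal.ofReal r < EMetric.diam S →
    ∃ Γ : Set (Euc n), IsLipschitzGraph n M Γ ∧
      ENNReal.ofReal (θ' * r ^ n) ≤ μH[(n : ℝ)] (ball x r ∩ S ∩ Γ)

/-- One step of the second difference energy estimate. -/
lemma energy_step {n : ℕ} {W : Type*} [NormedAddCommGroup W] [InnerProductSpace ℝ W]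
    [MeasurableSpace W] [BorelSpace W]
    (f : (Fin n → ℝ) → W) (hf : Continuous f) (v : Fin n → ℝ) (R h : ℝ) (hh : 0 < h) :
    (∫⁻ x in ball (0 : Fin n → ℝ) (R - 2 * h * ‖v‖),
        ENNReal.ofReal (‖f (x + (2 * h) • v) - (2 : ℝ) • f (x + h • v) + f x‖ ^ 2 / (4 * h ^ 2))) +
      (∫⁻ x in ball (0 : Fin n → ℝ) (R - 2 * h * ‖v‖),
        ENNReal.ofReal (‖f (x + (2 * h) • v) - f x‖ ^ 2 / (2 * h) ^ 2)) ≤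
      ∫⁻ x in ball (0 : Fin n → ℝ) (R - h * ‖v‖),
        ENNReal.ofReal (‖f (x + h • v) - f x‖ ^ 2 / h ^ 2) := by
  set F : (Fin n → ℝ) → ℝ≥0∞ := fun x => ENNReal.ofReal (‖f (x + h • v) - f x‖ ^ 2 / h ^ 2) with hF
  have hFm : Measurable F := by
    apply Measurable.ennreal_ofReal
    apply Continuous.measurable
    fun_prop
  have hsub1 : ball (0 : Fin n → ℝ) (R - 2 * h * ‖v‖) ⊆ ball 0 (R - h * ‖v‖) := by
    apply ball_subset_ball
    have : 0 ≤ h * ‖v‖ := by positivity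
    linarith
  have h1 : ∫⁻ x in ball (0 : Fin n → ℝ) (R - 2 * h * ‖v‖), F x ≤
      ∫⁻ x in ball (0 : Fin n → ℝ) (R - h * ‖v‖), F x := lintegral_mono_set hsub1
  have h2 : ∫⁻ x in ball (0 : Fin n → ℝ) (R - 2 * h * ‖v‖), F (x + h • v) ≤
      ∫⁻ x in ball (0 : Fin n → ℝ) (R - h * ‖v‖), F x := by
    rw [← lintegral_indicator measurableSet_ball, ← lintegral_indicator measurableSet_ball,
      ← lintegral_add_right_eq_self (indicator (ball (0 : Fin n → ℝ) (R - h * ‖v‖)) F) (h • v)]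
    apply lintegral_mono
    intro x
    by_cases hx : x ∈ ball (0 : Fin n → ℝ) (R - 2 * h * ‖v‖)
    · have hx' : x + h • v ∈ ball (0 : Fin n → ℝ) (R - h * ‖v‖) := by
        rw [mem_ball_zero_iff] at hx ⊢
        have := norm_add_le x (h • v)
        rw [norm_smul, Real.norm_of_nonneg hh.le] at this
        linarith
      simp only [indicator_of_mem hx, indicator_of_mem hx', le_refl]
    · simp only [indicator_of_notMem hx, zero_le]
  have key : ∀ x, ENNReal.ofReal (‖f (x + (2 * h) • v) - (2 : ℝ) • f (x + h • v) + f x‖ ^ 2 / (4 * h ^ 2)) +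
      ENNReal.ofReal (‖f (x + (2 * h) • v) - f x‖ ^ 2 / (2 * h) ^ 2) =
      (2 : ℝ≥0∞)⁻¹ * (F x + F (x + h • v)) := by
    intro x
    have e1 : x + h • v + h • v = x + (2 * h) • v := by
      rw [two_mul, add_smul]; abel
    simp only [hF, e1]
    rw [← ENNReal.ofReal_add (by positivity) (by positivity),
      ← ENNReal.ofReal_add (by positivity) (by positivity)]
    have : (2 : ℝ≥0∞)⁻¹ = ENNReal.ofReal (2⁻¹) := by
      rw [ENNReal.ofReal_inv_of_pos (by norm_num)]; norm_num
    rw [this, ← ENNReal.ofReal_mul (by norm_num)]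
    congr 1
    have pl := parallelogram_law_with_norm ℝ (f (x + (2 * h) • v) - f (x + h • v)) (f (x + h • v) - f x)
    have e2 : f (x + (2 * h) • v) - f (x + h • v) + (f (x + h • v) - f x) =
      f (x + (2 * h) • v) - f x := by abel
    have e3 : f (x + (2 * h) • v) - f (x + h • v) - (f (x + h • v) - f x) =
      f (x + (2 * h) • v) - (2 : ℝ) • f (x + h • v) + f x := by rw [two_smul]; abel
    rw [e2, e3] at pl
    field_simp
    nlinarith [pl]
  rw [← lintegral_add_left]
  · simp_rw [key]
    rw [lintegral_const_mul _ (by fun_prop), lintegral_add_left hFm]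
    calc _ ≤ (2 : ℝ≥0∞)⁻¹ * ((∫⁻ x in ball (0 : Fin n → ℝ) (R - h * ‖v‖), F x) +
          ∫⁻ x in ball (0 : Fin n → ℝ) (R - h * ‖v‖), F x) := by gcongr
      _ = _ := by
        rw [← two_mul, ← mul_assoc, ENNReal.inv_mul_cancel (by norm_num) (by norm_num), one_mul]
  · apply Measurable.ennreal_ofReal
    apply Continuous.measurable
    fun_prop

lemma energy_sum {n : ℕ} {W : Type*} [NormedAddCommGroup W] [InnerProductSpace ℝ W]
    [MeasurableSpace W] [BorelSpace W]
    (f : (Fin n → ℝ) → W) (K : ℝ≥0) (hf : LipschitzWith K f) (v : Fin n → ℝ) (R h : ℝ) (hh : 0 < h)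
    (m : ℕ) :
    ∑ k ∈ Finset.range m, (∫⁻ x in ball (0 : Fin n → ℝ) R,
        ENNReal.ofReal (‖f (x + (2 * (h / 2 ^ k)) • v) - (2 : ℝ) • f (x + (h / 2 ^ k) • v) + f x‖ ^ 2
          / (4 * (h / 2 ^ k) ^ 2))) ≤
      ENNReal.ofReal ((K * ‖v‖) ^ 2) * volume (ball (0 : Fin n → ℝ) (R + 2 * h * ‖v‖)) := by
  set R' := R + 2 * h * ‖v‖ with hR'
  have hind : ∀ m : ℕ, ∑ k ∈ Finset.range m, (∫⁻ x in ball (0 : Fin n → ℝ) R,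
        ENNReal.ofReal (‖f (x + (2 * (h / 2 ^ k)) • v) - (2 : ℝ) • f (x + (h / 2 ^ k) • v) + f x‖ ^ 2
          / (4 * (h / 2 ^ k) ^ 2))) ≤ ∫⁻ x in ball (0 : Fin n → ℝ) (R' - (2 * h / 2 ^ m) * ‖v‖),
        ENNReal.ofReal (‖f (x + (2 * h / 2 ^ m) • v) - f x‖ ^ 2 / (2 * h / 2 ^ m) ^ 2) := by
    intro m
    induction m with
    | zero => simp
    | succ m ih =>
      rw [Finset.sum_range_succ]
      have st := energy_step f hf.continuous v R' (h / 2 ^ m) (by positivity)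
      have e1 : 2 * h / 2 ^ (m + 1) = h / 2 ^ m := by
        rw [pow_succ]; field_simp
      have e2 : 2 * h / 2 ^ m = 2 * (h / 2 ^ m) := by ring
      rw [e1]
      rw [e2] at ih
      refine le_trans ?_ st
      rw [add_comm]
      refine add_le_add ?_ ih
      apply lintegral_mono_set
      apply ball_subset_ball
      have : 2 * (h / 2 ^ m) * ‖v‖ ≤ 2 * h * ‖v‖ := by
        have : h / 2 ^ m ≤ h := div_le_self hh.le (one_le_pow₀ (by norm_num))
        gcongr
      linarith
  refine (hind m).trans ?_
  have hp : 0 < 2 * h / 2 ^ m := by positivity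
  calc _ ≤ ∫⁻ x in ball (0 : Fin n → ℝ) (R' - (2 * h / 2 ^ m) * ‖v‖), ENNReal.ofReal ((K * ‖v‖) ^ 2) := by
        apply lintegral_mono
        intro x
        apply ENNReal.ofReal_le_ofReal
        rw [div_le_iff₀ (by positivity), ← mul_pow]
        have := hf.dist_le_mul (x + (2 * h / 2 ^ m) • v) x
        rw [dist_eq_norm, dist_eq_norm, add_sub_cancel_left, norm_smul, Real.norm_of_nonneg hp.le] at this
        gcongr
        linarith
    _ = ENNReal.ofReal ((K * ‖v‖) ^ 2) * volume (ball (0 : Fin n → ℝ) (R' - (2 * h / 2 ^ m) * ‖v‖)) := by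
        rw [setLIntegral_const]
    _ ≤ _ := by
        gcongr
        have : 0 ≤ 2 * h / 2 ^ m * ‖v‖ := by positivity
        linarith

/-- The linear map with columns `A i`. -/
def linc {n : ℕ} {W : Type*} [NormedAddCommGroup W] [InnerProductSpace ℝ W]
    (A : Fin n → W) (x : Fin n → ℝ) : W := ∑ i, x i • A i

section
variable {n : ℕ} {W : Type*} [NormedAddCommGroup W] [InnerProductSpace ℝ W]

lemma linc_norm_le (A : Fin n → W) (a : ℝ) (hA : ∀ i, ‖A i‖ ≤ a) (x : Fin n → ℝ) :
    ‖linc A x‖ ≤ n * a * ‖x‖ := by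
  unfold linc
  calc _ ≤ ∑ i : Fin n, ‖x i • A i‖ := norm_sum_le _ _
    _ ≤ ∑ i : Fin n, a * ‖x‖ := by
      apply Finset.sum_le_sum
      intro i _
      rw [norm_smul, mul_comm]
      have := norm_le_pi_norm x i
      have h2 := hA i
      have h3 := norm_nonneg (A i)
      gcongr
      linarith
    _ = _ := by simp; ring

lemma linc_sub (A : Fin n → W) (x y : Fin n → ℝ) : linc A (x - y) = linc A x - linc A y := by
  simp [linc, sub_smul]

lemma linc_add (A : Fin n → W) (x y : Fin n → ℝ) : linc A (x + y) = linc A x + linc A y := by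
  simp [linc, add_smul, Finset.sum_add_distrib]

lemma linc_smul (A : Fin n → W) (c : ℝ) (x : Fin n → ℝ) : linc A (c • x) = c • linc A x := by
  simp [linc, mul_smul, Finset.smul_sum]

lemma linc_single (A : Fin n → W) (i : Fin n) (c : ℝ) : linc A (Pi.single i c) = c • A i := by
  unfold linc
  rw [Finset.sum_eq_single i]
  · simp
  · intro j _ hj; simp [hj]
  · simp

lemma linc_sub_left (A B : Fin n → W) (x : Fin n → ℝ) :
    linc (fun i => A i - B i) x = linc A x - linc B x := by
  simp [linc, smul_sub]

lemma norm_single_one_le (i : Fin n) : ‖(Pi.single i 1 : Fin n → ℝ)‖ ≤ 1 := by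
  rw [pi_norm_le_iff_of_nonneg zero_le_one]
  intro j
  by_cases h : j = i
  · subst h; simp
  · simp [h]

/-- `f` is almost affine near `x` at scale `l`. -/
def AffAt (f : (Fin n → ℝ) → W) (ε : ℝ) (x : Fin n → ℝ) (l : ℝ) : Prop :=
  ∃ A : Fin n → W, ∀ y ∈ closedBall x (2 * l), ∀ y' ∈ closedBall x (2 * l),
    ‖f y - f y' - linc A (y - y')‖ ≤ ε * l

lemma lattice_aux (g : (Fin n → ℕ) → W) (δ : ℝ) (N : ℕ)
    (hg : ∀ j : Fin n → ℕ, (∀ i, j i ≤ N) → ∀ i k,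
      ‖g (j + Pi.single i 1 + Pi.single k 1) - g (j + Pi.single i 1) - g (j + Pi.single k 1) + g j‖ ≤ δ)
    (m : ℕ) : ∀ j : Fin n → ℕ, ∑ i, j i = m → m ≤ N →
      (∀ i, ‖g (j + Pi.single i 1) - g j - (g (Pi.single i 1) - g 0)‖ ≤ m * δ) ∧
      ‖g j - g 0 - ∑ i, (j i : ℝ) • (g (Pi.single i 1) - g 0)‖ ≤ m ^ 2 * δ := by
  induction m with
  | zero =>
    intro j hj _
    have : j = 0 := by
      ext i
      have := (Finset.sum_eq_zero_iff.mp hj) i (Finset.mem_univ i)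
      simpa using this
    subst this
    simp
  | succ m ih =>
    intro j hj hm
    have hex : ∃ k, 0 < j k := by
      by_contra hcon
      push Not at hcon
      have : ∑ i, j i = 0 := Finset.sum_eq_zero (fun i _ => Nat.le_zero.mp (hcon i))
      omega
    obtain ⟨k, hk⟩ := hex
    obtain ⟨j', rfl⟩ : ∃ j' : Fin n → ℕ, j = j' + Pi.single k 1 := by
      refine ⟨j - Pi.single k 1, ?_⟩
      ext i
      by_cases hik : i = k
      · subst hik; simp; omega
      · simp [hik]
    have hj' : ∑ i, j' i = m := by
      simp only [Pi.add_apply, Finset.sum_add_distrib] at hj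
      rw [Finset.sum_pi_single' k 1 Finset.univ] at hj
      simp at hj
      exact hj
    obtain ⟨ih1, ih2⟩ := ih j' hj' (by omega)
    have hle : ∀ i, j' i ≤ N := fun i => by
      have := Finset.single_le_sum (f := j') (fun i _ => Nat.zero_le _) (Finset.mem_univ i)
      omega
    have hδ : 0 ≤ δ := (norm_nonneg _).trans (hg j' hle k k)
    constructor
    · intro i
      have h1 := hg j' hle i k
      have h2 := ih1 i
      have e : g (j' + Pi.single k 1 + Pi.single i 1) - g (j' + Pi.single k 1) - (g (Pi.single i 1) - g 0) =
        (g (j' + Pi.single i 1 + Pi.single k 1) - g (j' + Pi.single i 1) - g (j' + Pi.single k 1) + g j')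
        + (g (j' + Pi.single i 1) - g j' - (g (Pi.single i 1) - g 0)) := by
        rw [add_right_comm]; abel
      rw [e]
      refine (norm_add_le _ _).trans ?_
      push_cast
      linarith
    · have h1 := ih1 k
      have e : g (j' + Pi.single k 1) - g 0 - ∑ i, (((j' + Pi.single k 1 : Fin n → ℕ) i : ℕ) : ℝ) • (g (Pi.single i 1) - g 0)
        = (g j' - g 0 - ∑ i, (j' i : ℝ) • (g (Pi.single i 1) - g 0)) +
          (g (j' + Pi.single k 1) - g j' - (g (Pi.single k 1) - g 0)) := by
        have : ∑ i, (((j' + Pi.single k 1 : Fin n → ℕ) i : ℕ) : ℝ) • (g (Pi.single i 1) - g 0) =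
          ∑ i, (j' i : ℝ) • (g (Pi.single i 1) - g 0) + (g (Pi.single k 1) - g 0) := by
          simp only [Pi.add_apply, Nat.cast_add, add_smul, Finset.sum_add_distrib]
          congr 1
          rw [Finset.sum_eq_single k]
          · simp
          · intro b _ hb; simp [hb]
          · simp
        rw [this]; abel
      rw [e]
      refine (norm_add_le _ _).trans ?_
      push_cast
      nlinarith

lemma coercive (n : ℕ) (W : Type*) [NormedAddCommGroup W] [InnerProductSpace ℝ W]
    (K : ℝ≥0) (ε : ℝ) (hε : 0 < ε) :
    ∃ (U : Finset ((Fin n → ℝ) × (Fin n → ℝ))) (P : ℕ) (δ : ℝ), 0 < P ∧ 0 < δ ∧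
      ∀ f : (Fin n → ℝ) → W, LipschitzWith K f → ∀ (x : Fin n → ℝ) (l : ℝ), 0 < l →
        (∀ p ∈ U, ‖f (x + (l / P) • p.1 + (2 * (l / P)) • p.2) -
          (2 : ℝ) • f (x + (l / P) • p.1 + (l / P) • p.2) + f (x + (l / P) • p.1)‖ ≤ δ * (l / P)) →
        AffAt f ε x l := by
  obtain ⟨P0, hP0⟩ := exists_nat_ge (4 * (n + 1) * K / ε)
  set P := P0 + 1 with hP
  have hPpos : (0 : ℝ) < P := by positivity
  have hPge : 4 * (n + 1) * K ≤ ε * P := by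
    rw [div_le_iff₀ hε] at hP0
    push_cast [hP]
    nlinarith
  set N : ℕ := 4 * P * n with hN
  set δ : ℝ := ε / (8 * (N ^ 2 + 1)) with hδdef
  have hδ : 0 < δ := by positivity
  classical
  set J : Finset (Fin n → ℕ) := Fintype.piFinset (fun _ => Finset.range (N + 1))
  set base : (Fin n → ℕ) → (Fin n → ℝ) := fun j i => (j i : ℝ) - 2 * P with hbase
  set e : Fin n → (Fin n → ℝ) := fun i => Pi.single i 1 with he
  set U1 : Finset ((Fin n → ℝ) × (Fin n → ℝ)) :=
    (J ×ˢ (Finset.univ : Finset (Fin n × Fin n))).image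
      (fun q => (base q.1, (2⁻¹ : ℝ) • (e q.2.1 + e q.2.2)))
  set U2 : Finset ((Fin n → ℝ) × (Fin n → ℝ)) :=
    (J ×ˢ (Finset.univ : Finset (Fin n × Fin n))).image
      (fun q => (base q.1 + e q.2.1, (2⁻¹ : ℝ) • (e q.2.2 - e q.2.1)))
  refine ⟨U1 ∪ U2, P, δ, by positivity, hδ, ?_⟩
  intro f hf x l hl hU
  set h := l / P with hh
  have hhpos : 0 < h := by positivity
  have hlP : l = P * h := by rw [hh]; field_simp
  set pt : (Fin n → ℕ) → (Fin n → ℝ) := fun j => x + h • base j with hpt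
  set g : (Fin n → ℕ) → W := fun j => f (pt j) with hg
  have hptadd : ∀ j i, pt (j + Pi.single i 1) = pt j + h • e i := by
    intro j i
    ext t
    simp only [hpt, hbase, he, Pi.add_apply, Pi.smul_apply, smul_eq_mul]
    by_cases hti : t = i
    · subst hti; simp; ring
    · simp [hti]
  have hmix : ∀ j : Fin n → ℕ, (∀ i, j i ≤ N) → ∀ i k,
      ‖g (j + Pi.single i 1 + Pi.single k 1) - g (j + Pi.single i 1) - g (j + Pi.single k 1) + g j‖
        ≤ 2 * (δ * h) := by
    intro j hj i k
    have hjJ : j ∈ J := by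
      rw [Fintype.mem_piFinset]; intro i; rw [Finset.mem_range]; have := hj i; omega
    have a1 := hU (base j, (2⁻¹ : ℝ) • (e i + e k)) (Finset.mem_union_left _
      (Finset.mem_image.mpr ⟨(j, (i, k)), by simp [hjJ], rfl⟩))
    have a2 := hU (base j + e i, (2⁻¹ : ℝ) • (e k - e i)) (Finset.mem_union_right _
      (Finset.mem_image.mpr ⟨(j, (i, k)), by simp [hjJ], rfl⟩))
    simp only at a1 a2
    have b1 : x + h • base j + (2 * h) • (2⁻¹ : ℝ) • (e i + e k) = pt (j + Pi.single i 1 + Pi.single k 1) := by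
      rw [hptadd, hptadd, hpt]
      ext t; simp; ring
    have b2 : x + h • (base j + e i) + (2 * h) • (2⁻¹ : ℝ) • (e k - e i) = pt (j + Pi.single k 1) := by
      rw [hptadd, hpt]
      ext t; simp; ring
    have b3 : x + h • (base j + e i) + h • (2⁻¹ : ℝ) • (e k - e i) =
        x + h • base j + h • (2⁻¹ : ℝ) • (e i + e k) := by
      ext t; simp; ring
    have b4 : x + h • (base j + e i) = pt (j + Pi.single i 1) := by
      rw [hptadd, hpt]
      ext t; simp; ring
    rw [b1] at a1
    rw [b2, b3, b4] at a2
    have := norm_sub_le_of_le a1 a2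
    refine le_trans (le_of_eq ?_) (this.trans (by linarith))
    congr 1
    simp only [hg, hpt]
    abel
  have hlat := fun j hj => (lattice_aux g (2 * (δ * h)) N hmix (∑ i, j i) j rfl hj).2
  set A : Fin n → W := fun i => h⁻¹ • (g (Pi.single i 1) - g 0) with hA
  have hAn : ∀ i, ‖A i‖ ≤ K := by
    intro i
    rw [hA]
    simp only
    rw [norm_smul, norm_inv, Real.norm_of_nonneg hhpos.le, inv_mul_le_iff₀ hhpos]
    have := hf.dist_le_mul (pt (Pi.single i 1)) (pt 0)
    have e1 : pt (Pi.single i 1) = pt 0 + h • e i := by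
      have := hptadd 0 i
      rwa [zero_add] at this
    rw [dist_eq_norm, dist_eq_norm, e1, add_sub_cancel_left, norm_smul, Real.norm_of_nonneg hhpos.le] at this
    have e2 : ‖e i‖ ≤ 1 := by
      rw [he]; exact norm_single_one_le i
    have hK := K.coe_nonneg
    have e3 : ‖g (Pi.single i 1) - g 0‖ ≤ K * (h * ‖e i‖) := by
      simp only [hg, e1]; exact this
    calc _ ≤ (K : ℝ) * (h * ‖e i‖) := e3
      _ ≤ K * (h * 1) := by gcongr
      _ = _ := by ring
  have hmain : ∀ y ∈ closedBall x (2 * l), ‖f y - f (pt 0) - linc A (y - pt 0)‖ ≤ ε * l / 2 := by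
    intro y hy
    rw [mem_closedBall, dist_pi_le_iff (by positivity)] at hy
    set j : Fin n → ℕ := fun i => ⌊(y i - pt 0 i) / h⌋₊ with hj
    have hpt0 : ∀ i, pt 0 i = x i - 2 * l := by
      intro i; simp only [hpt, hbase, Pi.add_apply, Pi.smul_apply, smul_eq_mul, Pi.zero_apply, Nat.cast_zero]
      rw [hlP]; ring
    have hy0 : ∀ i, 0 ≤ (y i - pt 0 i) / h := by
      intro i
      apply div_nonneg _ hhpos.le
      have := hy i
      rw [Real.dist_eq, abs_le] at this
      rw [hpt0]; linarith [this.1]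
    have hy1 : ∀ i, (y i - pt 0 i) / h ≤ (4 * P : ℕ) := by
      intro i
      rw [div_le_iff₀ hhpos]
      have := hy i
      rw [Real.dist_eq, abs_le] at this
      rw [hpt0]; push_cast
      have h2 := this.2
      rw [hlP] at h2 ⊢
      linarith
    have hjle : ∀ i, j i ≤ 4 * P := fun i => Nat.floor_le_of_le (hy1 i)
    have hsum : ∑ i, j i ≤ N := by
      calc _ ≤ ∑ i : Fin n, 4 * P := Finset.sum_le_sum (fun i _ => hjle i)
        _ = N := by simp [hN]; ring
    have c1 := hlat j hsum
    have hptj : ∀ i, pt j i = pt 0 i + h * j i := by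
      intro i; simp only [hpt, hbase, Pi.add_apply, Pi.smul_apply, smul_eq_mul, Pi.zero_apply, Nat.cast_zero]
      ring
    have hdist : ‖y - pt j‖ ≤ h := by
      rw [pi_norm_le_iff_of_nonneg hhpos.le]
      intro i
      rw [Pi.sub_apply, hptj, Real.norm_eq_abs, abs_le]
      have f1 : (j i : ℝ) ≤ (y i - pt 0 i) / h := Nat.floor_le (hy0 i)
      have f2 : (y i - pt 0 i) / h < j i + 1 := Nat.lt_floor_add_one _
      rw [le_div_iff₀ hhpos] at f1
      rw [div_lt_iff₀ hhpos] at f2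
      constructor <;> linarith
    have d1 : ‖f y - f (pt j)‖ ≤ K * h := by
      have := hf.dist_le_mul y (pt j)
      rw [dist_eq_norm, dist_eq_norm] at this
      exact this.trans (by gcongr)
    have d2 : ‖linc A (y - pt j)‖ ≤ n * K * h := by
      refine (linc_norm_le A K hAn _).trans ?_
      gcongr
    have d3 : linc A (pt j - pt 0) = ∑ i, (j i : ℝ) • (g (Pi.single i 1) - g 0) := by
      unfold linc
      apply Finset.sum_congr rfl
      intro i _
      rw [Pi.sub_apply, hptj, hA, smul_smul]
      congr 1
      field_simp
      ring
    have d4 : f y - f (pt 0) - linc A (y - pt 0) = (f y - f (pt j)) +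
      (g j - g 0 - ∑ i, (j i : ℝ) • (g (Pi.single i 1) - g 0)) - linc A (y - pt j) := by
      rw [← d3, linc_sub, linc_sub, linc_sub]
      simp only [hg]
      abel
    rw [d4]
    refine (norm_sub_le _ _).trans ?_
    refine (add_le_add (norm_add_le _ _) le_rfl).trans ?_
    have hsumR : ((∑ i, j i : ℕ) : ℝ) ^ 2 ≤ (N : ℝ) ^ 2 := by
      have : ((∑ i, j i : ℕ) : ℝ) ≤ (N : ℝ) := by exact_mod_cast hsum
      gcongr
    have d5 : ((∑ i, j i : ℕ) : ℝ) ^ 2 * (2 * (δ * h)) ≤ ε * h / 4 := by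
      calc _ ≤ (N : ℝ) ^ 2 * (2 * (δ * h)) := by gcongr
        _ ≤ ((N : ℝ) ^ 2 + 1) * (2 * (δ * h)) := by gcongr; linarith
        _ = ε * h / 4 := by rw [hδdef]; field_simp; ring
    have d6 : ε * h / 4 ≤ ε * l / 4 := by
      have : h ≤ l := by rw [hh]; exact div_le_self hl.le (by rw [hP]; push_cast; linarith [Nat.cast_nonneg (α := ℝ) P0])
      gcongr
    have d7 : K * h + n * K * h ≤ ε * l / 4 := by
      rw [hlP]; nlinarith
    linarith
  refine ⟨A, fun y hy y' hy' => ?_⟩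
  have q1 := hmain y hy
  have q2 := hmain y' hy'
  have : f y - f y' - linc A (y - y') = (f y - f (pt 0) - linc A (y - pt 0)) -
      (f y' - f (pt 0) - linc A (y' - pt 0)) := by
    rw [linc_sub, linc_sub, linc_sub]; abel
  rw [this]
  refine (norm_sub_le _ _).trans ?_
  linarith
end

/-- Index of the dyadic cube of side `r / 2 ^ k` containing `x`. -/
def didx {n : ℕ} (r : ℝ) (k : ℕ) (x : Fin n → ℝ) : Fin n → ℤ := fun i => ⌊x i / (r / 2 ^ k)⌋

/-- Dyadic cube of side `r / 2 ^ k` with index `j`. -/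
def dcube {n : ℕ} (r : ℝ) (k : ℕ) (j : Fin n → ℤ) : Set (Fin n → ℝ) := {x | didx r k x = j}

/-- Index of the dyadic parent. -/
def dpar {n : ℕ} (j : Fin n → ℤ) : Fin n → ℤ := fun i => j i / 2

lemma dpar_didx {n : ℕ} (r : ℝ) (k : ℕ) (x : Fin n → ℝ) :
    dpar (didx r (k + 1) x) = didx r k x := by
  ext i
  simp only [dpar, didx]
  have : x i / (r / 2 ^ k) = (x i / (r / 2 ^ (k + 1))) / (2 : ℕ) := by
    rw [pow_succ]; push_cast
    by_cases hr : r = 0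
    · simp [hr]
    · field_simp
  rw [this, Int.floor_div_natCast]
  rfl

lemma dcube_eq_pi {n : ℕ} (r : ℝ) (hr : 0 < r) (k : ℕ) (j : Fin n → ℤ) :
    dcube r k j = Set.pi univ (fun i => Ico ((j i : ℝ) * (r / 2 ^ k)) ((j i + 1 : ℝ) * (r / 2 ^ k))) := by
  ext x
  have hl : 0 < r / 2 ^ k := by positivity
  simp only [dcube, mem_ofPred_eq, didx, mem_pi, mem_univ, forall_true_left, mem_Ico, funext_iff]
  apply forall_congr'
  intro i
  rw [Int.floor_eq_iff, le_div_iff₀ hl, div_lt_iff₀ hl]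

lemma dcube_measurable {n : ℕ} (r : ℝ) (hr : 0 < r) (k : ℕ) (j : Fin n → ℤ) :
    MeasurableSet (dcube r k j) := by
  rw [dcube_eq_pi r hr]
  exact MeasurableSet.univ_pi (fun i => measurableSet_Ico)

lemma dcube_volume {n : ℕ} (r : ℝ) (hr : 0 < r) (k : ℕ) (j : Fin n → ℤ) :
    volume (dcube r k j) = ENNReal.ofReal ((r / 2 ^ k) ^ n) := by
  rw [dcube_eq_pi r hr, Real.volume_pi_Ico, ← ENNReal.ofReal_prod_of_nonneg]
  · congr 1
    simp [add_mul, div_pow]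
  · intro i _
    have : 0 < r / 2 ^ k := by positivity
    nlinarith

lemma dcube_norm_lt {n : ℕ} (r : ℝ) (hr : 0 < r) (k : ℕ) (j : Fin n → ℤ) (x y : Fin n → ℝ)
    (hx : x ∈ dcube r k j) (hy : y ∈ dcube r k j) : ‖x - y‖ < r / 2 ^ k := by
  rw [dcube_eq_pi r hr, mem_univ_pi] at hx hy
  have hl : 0 < r / 2 ^ k := by positivity
  rw [pi_norm_lt_iff hl]
  intro i
  have h1 := hx i
  have h2 := hy i
  rw [mem_Ico] at h1 h2
  rw [Pi.sub_apply, Real.norm_eq_abs, abs_lt]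
  constructor <;> linarith [h1.1, h1.2, h2.1, h2.2]

lemma dcube_self {n : ℕ} (r : ℝ) (k : ℕ) (x : Fin n → ℝ) : x ∈ dcube r k (didx r k x) := rfl

lemma dcube_iUnion_lintegral {n : ℕ} (r : ℝ) (hr : 0 < r) (k : ℕ) (S : Set (Fin n → ℝ))
    (hS : MeasurableSet S) (F : (Fin n → ℝ) → ℝ≥0∞) :
    ∫⁻ x in S, F x = ∑' j : Fin n → ℤ, ∫⁻ x in S ∩ dcube r k j, F x := by
  rw [← lintegral_iUnion]
  · congr 2
    ext x
    simp [dcube]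
  · exact fun j => hS.inter (dcube_measurable r hr k j)
  · intro i j hij
    rw [Function.onFun, Set.disjoint_left]
    rintro x ⟨_, hx⟩ ⟨_, hy⟩
    simp only [dcube, mem_ofPred_eq] at hx hy
    exact hij (hx.symm.trans hy)

section
variable {n : ℕ} {W : Type*} [NormedAddCommGroup W] [InnerProductSpace ℝ W]

/-- All points of the cube fail to be almost affine at the scale of the cube. -/
def BadC (f : (Fin n → ℝ) → W) (ε r : ℝ) (k : ℕ) (j : Fin n → ℤ) : Prop :=
  ∀ x ∈ dcube r k j, ¬ AffAt f ε x (r / 2 ^ k)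

lemma bad_sum (n : ℕ) (W : Type*) [NormedAddCommGroup W] [InnerProductSpace ℝ W]
    [MeasurableSpace W] [BorelSpace W]
    (K : ℝ≥0) (ε : ℝ) (hε : 0 < ε) :
    ∃ C : ℝ, 0 ≤ C ∧ ∀ f : (Fin n → ℝ) → W, LipschitzWith K f → ∀ r : ℝ, 0 < r →
      ∑' k : ℕ, volume {x ∈ dcube r 0 (0 : Fin n → ℤ) | BadC f ε r k (didx r k x)} ≤
        ENNReal.ofReal (C * r ^ n) := by
  obtain ⟨U, P, δ, hP, hδ, hco⟩ := coercive n W K ε hε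
  set c : (Fin n → ℝ) × (Fin n → ℝ) → ℝ := fun p =>
    4 / δ ^ 2 * ((K * ‖p.2‖) ^ 2 * (2 * (2 + ‖p.1‖ + 2 * ‖p.2‖)) ^ n) with hc
  have hc0 : ∀ p, 0 ≤ c p := fun p => by positivity
  refine ⟨∑ p ∈ U, c p, Finset.sum_nonneg (fun p _ => hc0 p), ?_⟩
  intro f hf r hr
  have hPR : (0 : ℝ) < P := by exact_mod_cast hP
  have hPR1 : (1 : ℝ) ≤ P := by exact_mod_cast hP
  set D : (Fin n → ℝ) × (Fin n → ℝ) → ℕ → (Fin n → ℝ) → ℝ≥0∞ := fun p k x =>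
    ENNReal.ofReal (‖f (x + (2 * (r / P / 2 ^ k)) • p.2) - (2 : ℝ) • f (x + (r / P / 2 ^ k) • p.2) + f x‖ ^ 2
          / (4 * (r / P / 2 ^ k) ^ 2)) with hD
  have hfc := hf.continuous
  have hDm : ∀ p k, Measurable (D p k) := by
    intro p k
    apply Measurable.ennreal_ofReal
    apply Continuous.measurable
    fun_prop
  have hstep : ∀ k, volume {x ∈ dcube r 0 (0 : Fin n → ℤ) | BadC f ε r k (didx r k x)} ≤
      ∑ p ∈ U, ENNReal.ofReal (4 / δ ^ 2) * ∫⁻ x in ball (0 : Fin n → ℝ) ((2 + ‖p.1‖) * r), D p k x := by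
    intro k
    have hk : 0 < r / P / 2 ^ k := by positivity
    have hkle : r / P / 2 ^ k ≤ r := by
      refine (div_le_self (by positivity) (one_le_pow₀ (by norm_num))).trans (div_le_self hr.le hPR1)
    set B := {x ∈ dcube r 0 (0 : Fin n → ℤ) | BadC f ε r k (didx r k x)} with hB
    calc volume B = ∫⁻ x in B, 1 := by simp
      _ ≤ ∫⁻ x in B, ∑ p ∈ U, ENNReal.ofReal (4 / δ ^ 2) * D p k (x + (r / P / 2 ^ k) • p.1) := by
        apply setLIntegral_mono
        · apply Finset.measurable_sum
          intro p _
          apply Measurable.const_mul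
          exact (hDm p k).comp (by fun_prop)
        · intro x hx
          have hna : ¬ AffAt f ε x (r / 2 ^ k) := hx.2 x (dcube_self r k x)
          have : ¬ _ := fun hh => hna (hco f hf x (r / 2 ^ k) (by positivity) hh)
          push Not at this
          obtain ⟨p, hpU, hp⟩ := this
          have hcomm : r / 2 ^ k / P = r / P / 2 ^ k := by ring
          rw [hcomm] at hp
          refine le_trans ?_ (Finset.single_le_sum (f := fun p => ENNReal.ofReal (4 / δ ^ 2) *
            D p k (x + (r / P / 2 ^ k) • p.1)) (fun _ _ => zero_le) hpU)
          simp only [hD]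
          rw [← ENNReal.ofReal_mul (by positivity), ENNReal.one_le_ofReal, div_mul_div_comm,
            le_div_iff₀ (by positivity)]
          have h0 : 0 ≤ δ * (r / P / 2 ^ k) := by positivity
          have := mul_self_le_mul_self h0 hp.le
          nlinarith [this]
      _ ≤ ∫⁻ x in dcube r 0 (0 : Fin n → ℤ), ∑ p ∈ U, ENNReal.ofReal (4 / δ ^ 2) * D p k (x + (r / P / 2 ^ k) • p.1) :=
        lintegral_mono_set (fun x hx => hx.1)
      _ = ∑ p ∈ U, ENNReal.ofReal (4 / δ ^ 2) * ∫⁻ x in dcube r 0 (0 : Fin n → ℤ), D p k (x + (r / P / 2 ^ k) • p.1) := by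
        rw [lintegral_finsetSum]
        · apply Finset.sum_congr rfl
          intro p _
          rw [lintegral_const_mul]
          exact (hDm p k).comp (by fun_prop)
        · intro p _
          apply Measurable.const_mul
          exact (hDm p k).comp (by fun_prop)
      _ ≤ _ := by
        apply Finset.sum_le_sum
        intro p _
        refine mul_le_mul' le_rfl ?_
        rw [← lintegral_indicator (dcube_measurable r hr 0 0), ← lintegral_indicator measurableSet_ball,
          ← lintegral_add_right_eq_self (indicator (ball (0 : Fin n → ℝ) ((2 + ‖p.1‖) * r)) (D p k))
            ((r / P / 2 ^ k) • p.1)]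
        apply lintegral_mono
        intro x
        by_cases hx : x ∈ dcube r 0 (0 : Fin n → ℤ)
        · have hx' : x + (r / P / 2 ^ k) • p.1 ∈ ball (0 : Fin n → ℝ) ((2 + ‖p.1‖) * r) := by
            rw [mem_ball_zero_iff]
            have h0 : (0 : Fin n → ℝ) ∈ dcube r 0 (0 : Fin n → ℤ) := by
              simp only [dcube, mem_ofPred_eq]; ext i; simp [didx]
            have h1 := dcube_norm_lt r hr 0 0 x 0 hx h0
            rw [sub_zero, pow_zero, div_one] at h1
            have h2 := norm_add_le x ((r / P / 2 ^ k) • p.1)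
            rw [norm_smul, Real.norm_of_nonneg hk.le] at h2
            have h3 : r / P / 2 ^ k * ‖p.1‖ ≤ r * ‖p.1‖ := by gcongr
            nlinarith
          simp only [indicator_of_mem hx, indicator_of_mem hx', le_refl]
        · simp only [indicator_of_notMem hx, zero_le]
  rw [ENNReal.tsum_eq_iSup_nat]
  apply iSup_le
  intro m
  calc _ ≤ ∑ k ∈ Finset.range m, ∑ p ∈ U, ENNReal.ofReal (4 / δ ^ 2) *
          ∫⁻ x in ball (0 : Fin n → ℝ) ((2 + ‖p.1‖) * r), D p k x := Finset.sum_le_sum (fun k _ => hstep k)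
    _ = ∑ p ∈ U, ENNReal.ofReal (4 / δ ^ 2) * ∑ k ∈ Finset.range m,
          ∫⁻ x in ball (0 : Fin n → ℝ) ((2 + ‖p.1‖) * r), D p k x := by
        rw [Finset.sum_comm]
        apply Finset.sum_congr rfl
        intro p _
        rw [Finset.mul_sum]
    _ ≤ ∑ p ∈ U, ENNReal.ofReal (c p * r ^ n) := by
        apply Finset.sum_le_sum
        intro p _
        have h1 := energy_sum f K hf p.2 ((2 + ‖p.1‖) * r) (r / P) (by positivity) m
        have hvol : volume (ball (0 : Fin n → ℝ) ((2 + ‖p.1‖) * r + 2 * (r / P) * ‖p.2‖)) ≤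
            ENNReal.ofReal ((2 * (2 + ‖p.1‖ + 2 * ‖p.2‖)) ^ n * r ^ n) := by
          rw [Real.volume_pi_ball _ (by positivity)]
          apply ENNReal.ofReal_le_ofReal
          rw [← mul_pow, Fintype.card_fin]
          have : r / P ≤ r := div_le_self hr.le hPR1
          have h3 : 2 * (r / P) * ‖p.2‖ ≤ 2 * r * ‖p.2‖ := by gcongr
          apply pow_le_pow_left₀ (by positivity)
          nlinarith
        calc _ ≤ ENNReal.ofReal (4 / δ ^ 2) * (ENNReal.ofReal ((K * ‖p.2‖) ^ 2) *
              ENNReal.ofReal ((2 * (2 + ‖p.1‖ + 2 * ‖p.2‖)) ^ n * r ^ n)) := by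
              gcongr
              exact h1.trans (by gcongr)
          _ = _ := by
            rw [← ENNReal.ofReal_mul (by positivity), ← ENNReal.ofReal_mul (by positivity)]
            congr 1
            simp only [hc]; ring
    _ = _ := by
        rw [← ENNReal.ofReal_sum_of_nonneg]
        · rw [Finset.sum_mul]
        · intro p _
          have := hc0 p
          positivity
end

lemma strip_vol {n : ℕ} (a b : Fin n → ℝ) (i : Fin n) (s l : ℝ) (hs : 0 < s) (hl : 0 < l)
    (hi : b i - a i = s) (ho : ∀ t, t ≠ i → b t - a t = l) :
    volume (Set.pi univ (fun t => Ico (a t) (b t))) = ENNReal.ofReal (s * l ^ (n - 1)) := by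
  rw [Real.volume_pi_Ico, ← ENNReal.ofReal_prod_of_nonneg]
  · congr 1
    rw [← Finset.mul_prod_erase Finset.univ _ (Finset.mem_univ i), hi]
    congr 1
    rw [Finset.prod_congr rfl (fun t ht => ho t (Finset.ne_of_mem_erase ht))]
    simp
  · intro t _
    by_cases h : t = i
    · subst h; linarith
    · rw [ho t h]; exact hl.le

lemma shift_bound {n : ℕ} {W : Type*} [NormedAddCommGroup W] [InnerProductSpace ℝ W]
    [FiniteDimensional ℝ W]
    (h : (Fin n → ℝ) → W) (hc : Continuous h) (r : ℝ) (hr : 0 < r) (k : ℕ) (j : Fin n → ℤ)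
    (i : Fin n) (s : ℝ) (hs : 0 < s) (b : ℝ)
    (hb : ∀ y ∈ dcube r k j, ‖h y‖ ≤ b) (hb' : ∀ y ∈ dcube r k j, ‖h (y + Pi.single i s)‖ ≤ b) :
    ‖∫ y in dcube r k j, (h (y + Pi.single i s) - h y)‖ ≤ 2 * b * (s * (r / 2 ^ k) ^ (n - 1)) := by
  set Q := dcube r k j with hQ
  have hl : 0 < r / 2 ^ k := by positivity
  have hQm : MeasurableSet Q := dcube_measurable r hr k j
  have hQv : volume Q < ∞ := by rw [hQ, dcube_volume r hr]; exact ENNReal.ofReal_lt_top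
  have hb0 : 0 ≤ b := by
    refine (norm_nonneg _).trans (hb (fun t => (j t : ℝ) * (r / 2 ^ k)) ?_)
    rw [hQ, dcube_eq_pi r hr, mem_univ_pi]
    intro t
    rw [mem_Ico]; constructor <;> nlinarith
  set e : Fin n → ℝ := Pi.single i s with he
  set I' : Set (Fin n → ℝ) := Q ∩ (fun y => y + e) ⁻¹' Q with hI'
  set I : Set (Fin n → ℝ) := Q ∩ (fun y => y - e) ⁻¹' Q with hI
  have hI'm : MeasurableSet I' := hQm.inter ((by fun_prop : Measurable (fun y : Fin n → ℝ => y + e)) hQm)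
  have hIm : MeasurableSet I := hQm.inter ((by fun_prop : Measurable (fun y : Fin n → ℝ => y - e)) hQm)
  have int1 : IntegrableOn h Q := 
    Measure.integrableOn_of_bounded hQv.ne hc.aestronglyMeasurable (M := b) 
      ((ae_restrict_iff' hQm).mpr (Filter.Eventually.of_forall hb))
  have hc2 : Continuous (fun y => h (y + e)) := by fun_prop
  have int2 : IntegrableOn (fun y => h (y + e)) Q := 
    Measure.integrableOn_of_bounded hQv.ne hc2.aestronglyMeasurable (M := b) 
      ((ae_restrict_iff' hQm).mpr (Filter.Eventually.of_forall hb'))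
  rw [integral_sub int2 int1]
  have s1 := integral_inter_add_sdiff (μ := volume) (s := Q) (t := I') hI'm int2
  have s2 := integral_inter_add_sdiff (μ := volume) (s := Q) (t := I) hIm int1
  have e1 : Q ∩ I' = I' := by rw [hI']; simp
  have e2 : Q ∩ I = I := by rw [hI]; simp
  rw [e1] at s1
  rw [e2] at s2
  have s3 : ∫ y in I', h (y + e) = ∫ y in I, h y := by
    rw [← integral_indicator hI'm, ← integral_indicator hIm, ← integral_add_right_eq_self (indicator I h) e]
    congr 1
    ext y
    have : y ∈ I' ↔ y + e ∈ I := by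
      simp [hI, hI', and_comm]
    by_cases hy : y ∈ I'
    · rw [indicator_of_mem hy, indicator_of_mem (this.mp hy)]
    · rw [indicator_of_notMem hy, indicator_of_notMem (fun hh => hy (this.mpr hh))]
  have v1 : volume (Q \ I') ≤ ENNReal.ofReal (s * (r / 2 ^ k) ^ (n - 1)) := by
    rw [← strip_vol (fun t => if t = i then (j t + 1 : ℝ) * (r / 2 ^ k) - s else (j t : ℝ) * (r / 2 ^ k))
      (fun t => (j t + 1 : ℝ) * (r / 2 ^ k)) i s (r / 2 ^ k) hs hl (by simp) (by intro t ht; simp [ht]; ring)]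
    apply measure_mono
    rintro y ⟨hy, hy2⟩
    have hy3 : y + e ∉ Q := fun hh => hy2 ⟨hy, hh⟩
    rw [hQ, dcube_eq_pi r hr, mem_univ_pi] at hy hy3
    rw [mem_univ_pi]
    push Not at hy3
    obtain ⟨t, ht⟩ := hy3
    have hti : t = i := by
      by_contra hne
      apply ht
      have := hy t
      simpa [he, hne] using this
    subst hti
    intro u
    have hyu := hy u
    rw [mem_Ico] at hyu ⊢
    refine ⟨?_, hyu.2⟩
    by_cases hut : u = t
    · subst hut
      simp only [he, Pi.add_apply, Pi.single_eq_same, mem_Ico] at ht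
      simp only [if_true]
      by_contra hcon
      push Not at hcon
      apply ht
      constructor <;> linarith [hyu.1]
    · simp only [hut, if_false]; exact hyu.1
  have v2 : volume (Q \ I) ≤ ENNReal.ofReal (s * (r / 2 ^ k) ^ (n - 1)) := by
    rw [← strip_vol (fun t => (j t : ℝ) * (r / 2 ^ k))
      (fun t => if t = i then (j t : ℝ) * (r / 2 ^ k) + s else (j t + 1 : ℝ) * (r / 2 ^ k)) i s (r / 2 ^ k) hs hl (by simp) (by intro t ht; simp [ht]; ring)]
    apply measure_mono
    rintro y ⟨hy, hy2⟩
    have hy3 : y - e ∉ Q := fun hh => hy2 ⟨hy, hh⟩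
    rw [hQ, dcube_eq_pi r hr, mem_univ_pi] at hy hy3
    rw [mem_univ_pi]
    push Not at hy3
    obtain ⟨t, ht⟩ := hy3
    have hti : t = i := by
      by_contra hne
      apply ht
      have := hy t
      simpa [he, hne] using this
    subst hti
    intro u
    have hyu := hy u
    rw [mem_Ico] at hyu ⊢
    refine ⟨hyu.1, ?_⟩
    by_cases hut : u = t
    · subst hut
      simp only [he, Pi.sub_apply, Pi.single_eq_same, mem_Ico] at ht
      simp only [if_true]
      by_contra hcon
      push Not at hcon
      apply ht
      constructor <;> linarith [hyu.2]
    · simp only [hut, if_false]; exact hyu.2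
  have hpos : 0 ≤ s * (r / 2 ^ k) ^ (n - 1) := by positivity
  have w1 : volume.real (Q \ I') ≤ s * (r / 2 ^ k) ^ (n - 1) :=
    ENNReal.toReal_le_of_le_ofReal hpos v1
  have w2 : volume.real (Q \ I) ≤ s * (r / 2 ^ k) ^ (n - 1) :=
    ENNReal.toReal_le_of_le_ofReal hpos v2
  have n1 : ‖∫ y in Q \ I', h (y + e)‖ ≤ b * volume.real (Q \ I') :=
    norm_setIntegral_le_of_norm_le_const (v1.trans_lt ENNReal.ofReal_lt_top) (fun y hy => hb' y hy.1)
  have n2 : ‖∫ y in Q \ I, h y‖ ≤ b * volume.real (Q \ I) :=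
    norm_setIntegral_le_of_norm_le_const (v2.trans_lt ENNReal.ofReal_lt_top) (fun y hy => hb y hy.1)
  rw [← s1, ← s2, s3, add_sub_add_left_eq_sub]
  refine (norm_sub_le _ _).trans ?_
  nlinarith [mul_le_mul_of_nonneg_left w1 hb0, mul_le_mul_of_nonneg_left w2 hb0]

section
variable {n : ℕ} {W : Type*} [NormedAddCommGroup W] [InnerProductSpace ℝ W] [FiniteDimensional ℝ W]
  [MeasurableSpace W] [BorelSpace W]

/-- Partial derivative. -/
def pder (f : (Fin n → ℝ) → W) (i : Fin n) (x : Fin n → ℝ) : W := lineDeriv ℝ f x (Pi.single i 1)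

lemma pder_norm_le (f : (Fin n → ℝ) → W) (K : ℝ≥0) (hf : LipschitzWith K f) (i : Fin n)
    (x : Fin n → ℝ) : ‖pder f i x‖ ≤ K := by
  have h1 := norm_lineDeriv_le_of_lipschitz ℝ (x₀ := x) (v := Pi.single i 1) hf
  have h2 := norm_single_one_le i
  have := K.coe_nonneg
  exact h1.trans (by nlinarith)

lemma pder_meas (f : (Fin n → ℝ) → W) (K : ℝ≥0) (hf : LipschitzWith K f) (i : Fin n) :
    Measurable (pder f i) := by
  have : CompleteSpace W := FiniteDimensional.complete ℝ W
  exact measurable_lineDeriv hf.continuous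

/-- Average of the gradient over a cube. -/
def avgS (f : (Fin n → ℝ) → W) (r : ℝ) (k : ℕ) (j : Fin n → ℤ) (i : Fin n) : W :=
  ⨍ y in dcube r k j, pder f i y

lemma avgS_consist (f : (Fin n → ℝ) → W) (K : ℝ≥0) (hf : LipschitzWith K f) (ε r : ℝ) (hε : 0 < ε)
    (hr : 0 < r) (k : ℕ) (j : Fin n → ℤ) (x : Fin n → ℝ) (hx : x ∈ dcube r k j) (A : Fin n → W)
    (hA : ∀ y ∈ closedBall x (2 * (r / 2 ^ k)), ∀ y' ∈ closedBall x (2 * (r / 2 ^ k)),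
      ‖f y - f y' - linc A (y - y')‖ ≤ ε * (r / 2 ^ k)) (i : Fin n) :
    ‖avgS f r k j i - A i‖ ≤ 2 * ε := by
  have hl : 0 < r / 2 ^ k := by positivity
  set l := r / 2 ^ k with hldef
  set Q := dcube r k j with hQ
  have hQm : MeasurableSet Q := dcube_measurable r hr k j
  have hQv' : volume Q = ENNReal.ofReal (l ^ n) := dcube_volume r hr k j
  have hQv : volume Q < ∞ := by rw [hQv']; exact ENNReal.ofReal_lt_top
  have hQr : volume.real Q = l ^ n := by
    rw [measureReal_def, hQv', ENNReal.toReal_ofReal (by positivity)]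
  set D : ℝ → (Fin n → ℝ) → W := fun s y => s⁻¹ • (f (y + s • Pi.single i 1) - f y) with hD
  have hfc := hf.continuous
  have hDc : ∀ s, Continuous (D s) := fun s => by simp only [hD]; fun_prop
  have hDb : ∀ s, 0 < s → ∀ y, ‖D s y‖ ≤ K := by
    intro s hs y
    simp only [hD]
    rw [norm_smul, norm_inv, Real.norm_of_nonneg hs.le, inv_mul_le_iff₀ hs]
    have h1 := hf.dist_le_mul (y + s • Pi.single i 1) y
    rw [dist_eq_norm, dist_eq_norm, add_sub_cancel_left, norm_smul, Real.norm_of_nonneg hs.le] at h1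
    have h2 := norm_single_one_le i
    refine h1.trans ?_
    have h3 : s * ‖(Pi.single i 1 : Fin n → ℝ)‖ ≤ s * 1 := by gcongr
    have := K.coe_nonneg
    nlinarith
  have hlim : Filter.Tendsto (fun s => ∫ y in Q, D s y) (nhdsWithin 0 (Ioi 0))
      (nhds (∫ y in Q, pder f i y)) := by
    apply tendsto_integral_filter_of_dominated_convergence (fun _ => (K : ℝ))
    · exact Filter.Eventually.of_forall (fun s => (hDc s).aestronglyMeasurable)
    · filter_upwards [self_mem_nhdsWithin] with s hs
      exact Filter.Eventually.of_forall (hDb s hs)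
    · exact (integrableOn_const (hQv.ne) )
    · apply ae_restrict_of_ae
      filter_upwards [hf.ae_differentiableAt (μ := volume)] with y hy
      have := (hy.lineDifferentiableAt (v := Pi.single i 1)).hasLineDerivAt.tendsto_slope_zero_right
      exact this
  have hbd : ∀ s, 0 < s → s ≤ l → ‖(∫ y in Q, D s y) - (l ^ n) • A i‖ ≤ 2 * ε * l ^ n := by
    intro s hs hsl
    set h : (Fin n → ℝ) → W := fun y => f y - f x - linc A (y - x) with hh
    have hhc : Continuous h := by
      simp only [hh, linc]; fun_prop
    have hin : ∀ y ∈ Q, y ∈ closedBall x (2 * l) ∧ y + Pi.single i s ∈ closedBall x (2 * l) := by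
      intro y hy
      have h1 := dcube_norm_lt r hr k j y x hy hx
      rw [← hldef] at h1
      have h2 : ‖(Pi.single i s : Fin n → ℝ)‖ ≤ l := by
        have : (Pi.single i s : Fin n → ℝ) = s • Pi.single i 1 := by
          ext t; by_cases hti : t = i
          · subst hti; simp
          · simp [hti]
        rw [this, norm_smul, Real.norm_of_nonneg hs.le]
        have := norm_single_one_le i
        nlinarith
      constructor
      · rw [mem_closedBall, dist_eq_norm]; linarith
      · rw [mem_closedBall, dist_eq_norm, add_sub_right_comm]
        exact (norm_add_le _ _).trans (by linarith)
    have hxx : x ∈ closedBall x (2 * l) := mem_closedBall_self (by positivity)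
    have key := shift_bound h hhc r hr k j i s hs (ε * l)
      (fun y hy => hA y (hin y hy).1 x hxx) (fun y hy => hA _ (hin y hy).2 x hxx)
    rw [← hldef, ← hQ] at key
    have hsing : (Pi.single i s : Fin n → ℝ) = s • Pi.single i 1 := by
      ext t; by_cases hti : t = i
      · subst hti; simp
      · simp [hti]
    have e1 : ∀ y, h (y + Pi.single i s) - h y = s • (D s y - A i) := by
      intro y
      simp only [hh, hD, smul_sub, smul_smul]
      rw [mul_inv_cancel₀ hs.ne', hsing]
      have : linc A (y + s • Pi.single i 1 - x) = linc A (y - x) + s • A i := by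
        rw [add_sub_right_comm, linc_add, linc_smul, linc_single, one_smul]
      rw [this]; simp; abel
    simp_rw [e1] at key
    rw [integral_smul, integral_sub, setIntegral_const, hQr, norm_smul, Real.norm_of_nonneg hs.le] at key
    · have hn : l * l ^ (n - 1) = l ^ n := by
        rw [← pow_succ', Nat.sub_add_cancel (by have := i.pos; omega)]
      rw [← hn]
      rw [← hn] at key
      have : s * ‖(∫ y in Q, D s y) - (l * l ^ (n - 1)) • A i‖ ≤ s * (2 * ε * (l * l ^ (n - 1))) :=
        key.trans (le_of_eq (by ring))
      exact le_of_mul_le_mul_left this hs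
    · exact Measure.integrableOn_of_bounded hQv.ne (hDc s).aestronglyMeasurable (M := K)
        (Filter.Eventually.of_forall (hDb s hs))
    · exact integrableOn_const hQv.ne
  have hfin : ‖(∫ y in Q, pder f i y) - (l ^ n) • A i‖ ≤ 2 * ε * l ^ n := by
    refine le_of_tendsto (hlim.sub_const _).norm ?_
    filter_upwards [Ioc_mem_nhdsGT hl] with s hs
    exact hbd s hs.1 hs.2
  have hln : 0 < l ^ n := by positivity
  have : avgS f r k j i - A i = (l ^ n)⁻¹ • ((∫ y in Q, pder f i y) - (l ^ n) • A i) := by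
    rw [avgS, setAverage_eq, ← hQ, hQr, smul_sub, smul_smul, inv_mul_cancel₀ hln.ne', one_smul]
  rw [this, norm_smul, norm_inv, Real.norm_of_nonneg hln.le, inv_mul_le_iff₀ hln]
  linarith

end

section
variable {n : ℕ} {W : Type*} [NormedAddCommGroup W] [InnerProductSpace ℝ W] [FiniteDimensional ℝ W]
  [MeasurableSpace W] [BorelSpace W]

lemma didx_measurable (r : ℝ) (k : ℕ) : Measurable (didx (n := n) r k) := by
  rw [measurable_pi_iff]
  intro i
  exact Int.measurable_floor.comp ((measurable_pi_apply i).div_const _)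

lemma didx_zero (r : ℝ) (k : ℕ) (x : Fin n → ℝ) : didx r 0 x = (dpar)^[k] (didx r k x) := by
  induction k with
  | zero => rfl
  | succ k ih => rw [ih, Function.iterate_succ_apply, dpar_didx]

lemma avgS_norm_le (f : (Fin n → ℝ) → W) (K : ℝ≥0) (hf : LipschitzWith K f) (r : ℝ) (hr : 0 < r)
    (k : ℕ) (j : Fin n → ℤ) (i : Fin n) : ‖avgS f r k j i‖ ≤ K := by
  have hl : 0 < r / 2 ^ k := by positivity
  have hQv : volume (dcube r k j) < ∞ := by rw [dcube_volume r hr]; exact ENNReal.ofReal_lt_top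
  have hQr : volume.real (dcube r k j) = (r / 2 ^ k) ^ n := by
    rw [measureReal_def, dcube_volume r hr, ENNReal.toReal_ofReal (by positivity)]
  have hln : 0 < (r / 2 ^ k) ^ n := by positivity
  rw [avgS, setAverage_eq, hQr, norm_smul, norm_inv, Real.norm_of_nonneg hln.le, inv_mul_le_iff₀ hln]
  have := norm_setIntegral_le_of_norm_le_const hQv (f := pder f i) (C := K)
    (fun x _ => pder_norm_le f K hf i x)
  rw [hQr] at this
  linarith

lemma avgS_pyth (f : (Fin n → ℝ) → W) (K : ℝ≥0) (hf : LipschitzWith K f) (r : ℝ) (hr : 0 < r)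
    (k : ℕ) (j : Fin n → ℤ) (i : Fin n) (c : W) :
    (∫⁻ x in dcube r k j, ENNReal.ofReal (‖pder f i x - avgS f r k j i‖ ^ 2)) +
      ∫⁻ _ in dcube r k j, ENNReal.ofReal (‖avgS f r k j i - c‖ ^ 2) =
    ∫⁻ x in dcube r k j, ENNReal.ofReal (‖pder f i x - c‖ ^ 2) := by
  have : CompleteSpace W := FiniteDimensional.complete ℝ W
  have hl : 0 < r / 2 ^ k := by positivity
  set Q := dcube r k j with hQ
  have hQv : volume Q < ∞ := by rw [dcube_volume r hr]; exact ENNReal.ofReal_lt_top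
  have hQr : volume.real Q = (r / 2 ^ k) ^ n := by
    rw [measureReal_def, dcube_volume r hr, ENNReal.toReal_ofReal (by positivity)]
  have hln : 0 < (r / 2 ^ k) ^ n := by positivity
  set m := avgS f r k j i with hm
  have hpm := pder_meas f K hf i
  have hInt : IntegrableOn (pder f i) Q :=
    Measure.integrableOn_of_bounded hQv.ne hpm.aestronglyMeasurable (M := K)
      (Filter.Eventually.of_forall (pder_norm_le f K hf i))
  have hsq : ∀ c : W, IntegrableOn (fun x => ‖pder f i x - c‖ ^ 2) Q := by
    intro c
    refine Measure.integrableOn_of_bounded hQv.ne ((hpm.sub_const c).norm.pow_const 2).aestronglyMeasurable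
      (M := (K + ‖c‖) ^ 2) (Filter.Eventually.of_forall (fun x => ?_))
    rw [Real.norm_of_nonneg (by positivity)]
    have h1 := norm_sub_le (pder f i x) c
    have h2 := pder_norm_le f K hf i x
    gcongr
    linarith
  have hconst : IntegrableOn (fun _ : Fin n → ℝ => ‖m - c‖ ^ 2) Q := integrableOn_const hQv.ne
  rw [← ofReal_integral_eq_lintegral_ofReal (hsq m) (Filter.Eventually.of_forall fun x => by positivity),
    ← ofReal_integral_eq_lintegral_ofReal hconst (Filter.Eventually.of_forall fun x => by positivity),
    ← ofReal_integral_eq_lintegral_ofReal (hsq c) (Filter.Eventually.of_forall fun x => by positivity),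
    ← ENNReal.ofReal_add (integral_nonneg fun x => by positivity) (integral_nonneg fun x => by positivity)]
  congr 1
  have hz : ∫ x in Q, inner ℝ (m - c) (pder f i x - m) = 0 := by
    have h0 : ∫ x in Q, (pder f i x - m) = 0 := by
      rw [integral_sub hInt (integrableOn_const hQv.ne), setIntegral_const, hQr, hm, avgS, setAverage_eq,
        ← hQ, hQr, smul_smul, mul_inv_cancel₀ hln.ne', one_smul, sub_self]
    rw [integral_inner, h0, inner_zero_right]
    exact hInt.sub (integrableOn_const hQv.ne)
  have hexp : ∀ x, ‖pder f i x - c‖ ^ 2 = ‖pder f i x - m‖ ^ 2 + ‖m - c‖ ^ 2 + 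
      2 * inner ℝ (m - c) (pder f i x - m) := by
    intro x
    have : pder f i x - c = (m - c) + (pder f i x - m) := by abel
    rw [this, norm_add_sq_real]; ring
  simp_rw [hexp]
  have hinn : IntegrableOn (fun x => 2 * inner ℝ (m - c) (pder f i x - m)) Q := by
    apply Integrable.const_mul
    exact Integrable.const_inner _ (hInt.sub (integrableOn_const hQv.ne))
  have hsum : IntegrableOn (fun x => ‖pder f i x - m‖ ^ 2 + ‖m - c‖ ^ 2) Q := (hsq m).add hconst
  rw [integral_add hsum hinn, integral_add (hsq m) hconst, integral_const_mul, hz]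
  ring

/-- Coherent slopes along the stopping-time trees. -/
def Lsl (f : (Fin n → ℝ) → W) (ε r : ℝ) : ℕ → (Fin n → ℤ) → Fin n → W
  | 0, j => avgS f r 0 j
  | k + 1, j =>
    open Classical in
    if BadC f ε r k (dpar j) ∨ ∃ i, ε < ‖avgS f r (k + 1) j i - Lsl f ε r k (dpar j) i‖
    then avgS f r (k + 1) j else Lsl f ε r k (dpar j)

/-- Tops of the trees. -/
def DTop (f : (Fin n → ℝ) → W) (ε r : ℝ) : ℕ → (Fin n → ℤ) → Prop
  | 0, _ => True
  | k + 1, j => BadC f ε r k (dpar j) ∨ ∃ i, ε < ‖avgS f r (k + 1) j i - Lsl f ε r k (dpar j) i‖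

lemma Lsl_of_top (f : (Fin n → ℝ) → W) (ε r : ℝ) (k : ℕ) (j : Fin n → ℤ) (h : DTop f ε r k j) :
    Lsl f ε r k j = avgS f r k j := by
  cases k with
  | zero => rfl
  | succ k => 
    rw [DTop] at h
    rw [Lsl, if_pos h]

lemma Lsl_of_not_top (f : (Fin n → ℝ) → W) (ε r : ℝ) (k : ℕ) (j : Fin n → ℤ)
    (h : ¬ DTop f ε r (k + 1) j) : Lsl f ε r (k + 1) j = Lsl f ε r k (dpar j) := by
  rw [DTop] at h
  rw [Lsl, if_neg h]

lemma Lsl_norm_le (f : (Fin n → ℝ) → W) (K : ℝ≥0) (hf : LipschitzWith K f) (ε r : ℝ) (hr : 0 < r)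
    (k : ℕ) : ∀ (j : Fin n → ℤ) (i : Fin n), ‖Lsl f ε r k j i‖ ≤ K := by
  induction k with
  | zero => intro j i; exact avgS_norm_le f K hf r hr 0 j i
  | succ k ih =>
    intro j i
    by_cases h : DTop f ε r (k + 1) j
    · rw [Lsl_of_top f ε r _ j h]; exact avgS_norm_le f K hf r hr _ j i
    · rw [Lsl_of_not_top f ε r _ j h]; exact ih _ i

/-- slope change -/
def SCh (f : (Fin n → ℝ) → W) (ε r : ℝ) (k : ℕ) (j : Fin n → ℤ) : Prop :=
  ∃ i, ε < ‖avgS f r (k + 1) j i - Lsl f ε r k (dpar j) i‖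

lemma J_step (f : (Fin n → ℝ) → W) (K : ℝ≥0) (hf : LipschitzWith K f) (ε r : ℝ) (hε : 0 < ε) (hr : 0 < r)
    (k : ℕ) :
    ENNReal.ofReal (ε ^ 2) * volume {x ∈ dcube r 0 (0 : Fin n → ℤ) | SCh f ε r k (didx r (k + 1) x)} +
      ∫⁻ x in dcube r 0 (0 : Fin n → ℤ), ∑ i, ENNReal.ofReal (‖pder f i x - Lsl f ε r (k + 1) (didx r (k + 1) x) i‖ ^ 2)
    ≤ ∫⁻ x in dcube r 0 (0 : Fin n → ℤ), ∑ i, ENNReal.ofReal (‖pder f i x - Lsl f ε r k (didx r k x) i‖ ^ 2) := by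
  classical
  set S : Set (Fin n → ℝ) := {x | SCh f ε r k (didx r (k + 1) x)} with hS
  have hSm : MeasurableSet S := didx_measurable r (k + 1) (MeasurableSet.of_discrete (s := {j | SCh f ε r k j}))
  have hQ0m := dcube_measurable r hr 0 (0 : Fin n → ℤ)
  have e1 : ENNReal.ofReal (ε ^ 2) * volume {x ∈ dcube r 0 (0 : Fin n → ℤ) | SCh f ε r k (didx r (k + 1) x)} =
      ∫⁻ x in dcube r 0 (0 : Fin n → ℤ), S.indicator (fun _ => ENNReal.ofReal (ε ^ 2)) x := by
    rw [lintegral_indicator hSm, setLIntegral_const, Measure.restrict_apply hSm, inter_comm]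
    rfl
  rw [e1, ← lintegral_add_left ((measurable_const).indicator hSm),
    dcube_iUnion_lintegral r hr (k + 1) _ hQ0m, dcube_iUnion_lintegral r hr (k + 1) _ hQ0m (fun x => ∑ i, ENNReal.ofReal (‖pder f i x - Lsl f ε r k (didx r k x) i‖ ^ 2))]
  apply ENNReal.tsum_le_tsum
  intro j
  by_cases hj : (dpar)^[k + 1] j = 0
  swap
  · have : dcube r 0 (0 : Fin n → ℤ) ∩ dcube r (k + 1) j = ∅ := by
      ext x
      simp only [mem_inter_iff, mem_empty_iff_false, iff_false, not_and]
      intro h1 h2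
      apply hj
      have h3 : didx r 0 x = 0 := h1
      have h4 : didx r (k + 1) x = j := h2
      rw [didx_zero r (k + 1), h4] at h3
      exact h3
    rw [this]; simp
  have hsub : dcube r 0 (0 : Fin n → ℤ) ∩ dcube r (k + 1) j = dcube r (k + 1) j := by
    apply inter_eq_right.mpr
    intro x hx
    have h4 : didx r (k + 1) x = j := hx
    show didx r 0 x = 0
    rw [didx_zero r (k + 1), h4, hj]
  rw [hsub]
  set q := dcube r (k + 1) j with hq
  have hqm : MeasurableSet q := dcube_measurable r hr _ j
  have r1 : ∫⁻ x in q, ∑ i, ENNReal.ofReal (‖pder f i x - Lsl f ε r k (didx r k x) i‖ ^ 2) =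
      ∑ i, ∫⁻ x in q, ENNReal.ofReal (‖pder f i x - Lsl f ε r k (dpar j) i‖ ^ 2) := by
    rw [← lintegral_finsetSum]
    · apply setLIntegral_congr_fun hqm
      intro x hx
      have h4 : didx r (k + 1) x = j := hx
      have h5 := dpar_didx r k x
      simp only
      rw [← h5, h4]
    · intro i _
      exact (((pder_meas f K hf i).sub_const _).norm.pow_const 2).ennreal_ofReal
  have r2 : ∫⁻ x in q, (S.indicator (fun _ => ENNReal.ofReal (ε ^ 2)) x + ∑ i, ENNReal.ofReal (‖pder f i x - Lsl f ε r (k + 1) (didx r (k + 1) x) i‖ ^ 2)) =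
      (∫⁻ x in q, (if SCh f ε r k j then ENNReal.ofReal (ε ^ 2) else 0)) + ∑ i, ∫⁻ x in q, ENNReal.ofReal (‖pder f i x - Lsl f ε r (k + 1) j i‖ ^ 2) := by
    rw [← lintegral_finsetSum, ← lintegral_add_left measurable_const]
    · apply setLIntegral_congr_fun hqm
      intro x hx
      have h4 : didx r (k + 1) x = j := hx
      simp only [h4, indicator, hS, mem_ofPred_eq]
    · intro i _
      exact (((pder_meas f K hf i).sub_const _).norm.pow_const 2).ennreal_ofReal
  rw [r1, r2]
  by_cases ht : DTop f ε r (k + 1) j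
  · rw [Lsl_of_top f ε r _ j ht]
    have : ∀ i, ∫⁻ x in q, ENNReal.ofReal (‖pder f i x - Lsl f ε r k (dpar j) i‖ ^ 2) = 
      (∫⁻ x in q, ENNReal.ofReal (‖avgS f r (k + 1) j i - Lsl f ε r k (dpar j) i‖ ^ 2)) + 
      ∫⁻ x in q, ENNReal.ofReal (‖pder f i x - avgS f r (k + 1) j i‖ ^ 2) := by
      intro i; rw [← avgS_pyth f K hf r hr (k + 1) j i, add_comm]
    simp_rw [this]
    rw [Finset.sum_add_distrib]
    gcongr
    split_ifs with hch
    · obtain ⟨i, hi⟩ := hch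
      refine le_trans ?_ (Finset.single_le_sum (f := fun i => ∫⁻ x in q, ENNReal.ofReal (‖avgS f r (k + 1) j i - Lsl f ε r k (dpar j) i‖ ^ 2)) (fun _ _ => zero_le) (Finset.mem_univ i))
      apply lintegral_mono
      intro x
      apply ENNReal.ofReal_le_ofReal
      gcongr
    · simp
  · rw [Lsl_of_not_top f ε r _ j ht]
    have : ¬ SCh f ε r k j := fun hh => ht (Or.inr hh)
    simp [this]

lemma SCh_sum (f : (Fin n → ℝ) → W) (K : ℝ≥0) (hf : LipschitzWith K f) (ε r : ℝ) (hε : 0 < ε) (hr : 0 < r) :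
    ENNReal.ofReal (ε ^ 2) * ∑' k, volume {x ∈ dcube r 0 (0 : Fin n → ℤ) | SCh f ε r k (didx r (k + 1) x)} ≤
      ENNReal.ofReal (n * (2 * K) ^ 2 * r ^ n) := by
  rw [ENNReal.tsum_eq_iSup_nat, ENNReal.mul_iSup]
  apply iSup_le
  intro m
  set J : ℕ → ℝ≥0∞ := fun k => ∫⁻ x in dcube r 0 (0 : Fin n → ℤ), ∑ i, ENNReal.ofReal (‖pder f i x - Lsl f ε r k (didx r k x) i‖ ^ 2) with hJ
  have h1 : ENNReal.ofReal (ε ^ 2) * ∑ k ∈ Finset.range m, volume {x ∈ dcube r 0 (0 : Fin n → ℤ) | SCh f ε r k (didx r (k + 1) x)} + J m ≤ J 0 := by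
    induction m with
    | zero => simp
    | succ m ih =>
      rw [Finset.sum_range_succ, mul_add, add_assoc]
      exact le_trans (by gcongr; exact J_step f K hf ε r hε hr m) ih
  refine le_self_add.trans (h1.trans ?_)
  have h2 : J 0 ≤ ∫⁻ x in dcube r 0 (0 : Fin n → ℤ), ENNReal.ofReal (n * (2 * K) ^ 2) := by
    apply lintegral_mono
    intro x
    simp only
    rw [← ENNReal.ofReal_sum_of_nonneg (fun i _ => by positivity)]
    apply ENNReal.ofReal_le_ofReal
    calc _ ≤ ∑ i : Fin n, (2 * (K : ℝ)) ^ 2 := by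
          apply Finset.sum_le_sum
          intro i _
          have a1 := norm_sub_le (pder f i x) (Lsl f ε r 0 (didx r 0 x) i)
          have a2 := pder_norm_le f K hf i x
          have a3 := Lsl_norm_le f K hf ε r hr 0 (didx r 0 x) i
          gcongr
          linarith
      _ = _ := by simp
  refine h2.trans ?_
  rw [setLIntegral_const, dcube_volume r hr, ← ENNReal.ofReal_mul (by positivity)]
  simp

end

lemma tsum_aux (F : ℕ → ℝ≥0∞) (C D R : ℝ) (hC : 0 ≤ C) (hD : 0 ≤ D) (hR : 0 ≤ R)
    (h1 : F 0 ≤ ENNReal.ofReal R)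
    (h2 : ∑' k, F (k + 1) ≤ ENNReal.ofReal (C * R) + ENNReal.ofReal (D * R)) :
    ∑' k, F k ≤ ENNReal.ofReal ((1 + C + D) * R) := by
  rw [tsum_eq_zero_add' ENNReal.summable]
  refine (add_le_add h1 h2).trans ?_
  rw [← ENNReal.ofReal_add (by positivity) (by positivity), ← ENNReal.ofReal_add (by positivity) (by positivity)]
  apply le_of_eq
  congr 1
  ring

lemma top_sum (n : ℕ) (W : Type*) [NormedAddCommGroup W] [InnerProductSpace ℝ W] [FiniteDimensional ℝ W]
    [MeasurableSpace W] [BorelSpace W]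
    (K : ℝ≥0) (ε : ℝ) (hε : 0 < ε) :
    ∃ C : ℝ, 0 ≤ C ∧ ∀ f : (Fin n → ℝ) → W, LipschitzWith K f → ∀ r : ℝ, 0 < r →
      ∑' k : ℕ, volume {x ∈ dcube r 0 (0 : Fin n → ℤ) | DTop f ε r k (didx r k x)} ≤
        ENNReal.ofReal (C * r ^ n) := by
  obtain ⟨C, hC, hbad⟩ := bad_sum n W K ε hε
  have hD0 : 0 ≤ (n : ℝ) * (2 * (K : ℝ)) ^ 2 / ε ^ 2 := by positivity
  generalize hDD : (n : ℝ) * (2 * (K : ℝ)) ^ 2 / ε ^ 2 = D at hD0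
  refine ⟨1 + C + D, by positivity, ?_⟩
  intro f hf r hr
  have hb := hbad f hf r hr
  have hs := SCh_sum f K hf ε r hε hr
  have hs' : ∑' k, volume {x ∈ dcube r 0 (0 : Fin n → ℤ) | SCh f ε r k (didx r (k + 1) x)} ≤
      ENNReal.ofReal (D * r ^ n) := by
    have h0 : ENNReal.ofReal (ε ^ 2) ≠ 0 := by
      rw [Ne, ENNReal.ofReal_eq_zero, not_le]; positivity
    rw [mul_comm, ← ENNReal.le_div_iff_mul_le (Or.inl h0) (Or.inl ENNReal.ofReal_ne_top),
      ← ENNReal.ofReal_div_of_pos (by positivity)] at hs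
    refine hs.trans (le_of_eq ?_)
    rw [← hDD]; congr 1; ring
  have h1 : volume {x ∈ dcube r 0 (0 : Fin n → ℤ) | DTop f ε r 0 (didx r 0 x)} ≤ ENNReal.ofReal (r ^ n) := by
    have hle : volume {x ∈ dcube r 0 (0 : Fin n → ℤ) | DTop f ε r 0 (didx r 0 x)} ≤ volume (dcube r 0 (0 : Fin n → ℤ)) :=
      measure_mono (fun x hx => hx.1)
    rw [dcube_volume r hr, pow_zero, div_one] at hle
    exact hle
  have h2 : ∑' k, volume {x ∈ dcube r 0 (0 : Fin n → ℤ) | DTop f ε r (k + 1) (didx r (k + 1) x)} ≤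
      ENNReal.ofReal (C * r ^ n) + ENNReal.ofReal (D * r ^ n) := by
    refine le_trans ?_ (add_le_add hb hs')
    rw [← ENNReal.tsum_add]
    apply ENNReal.tsum_le_tsum
    intro k
    have hsub : {x ∈ dcube r 0 (0 : Fin n → ℤ) | DTop f ε r (k + 1) (didx r (k + 1) x)} ⊆
        {x ∈ dcube r 0 (0 : Fin n → ℤ) | BadC f ε r k (didx r k x)} ∪
          {x ∈ dcube r 0 (0 : Fin n → ℤ) | SCh f ε r k (didx r (k + 1) x)} := by
      intro x hx
      have hx2 := hx.2
      rw [DTop, dpar_didx] at hx2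
      rcases hx2 with ht | ht
      · exact Or.inl ⟨hx.1, ht⟩
      · refine Or.inr ⟨hx.1, ?_⟩
        rw [SCh, dpar_didx]; exact ht
    exact (measure_mono hsub).trans (measure_union_le _ _)
  exact tsum_aux _ C D (r ^ n) hC hD0 (by positivity) h1 h2

section
variable {n : ℕ} {W : Type*} [NormedAddCommGroup W] [InnerProductSpace ℝ W] [FiniteDimensional ℝ W]
  [MeasurableSpace W] [BorelSpace W]

lemma tree_raw (f : (Fin n → ℝ) → W) (ε r : ℝ) (hε : 0 < ε) (x : Fin n → ℝ) (k : ℕ) :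
    ∃ t ≤ k, DTop f ε r t (didx r t x) ∧ Lsl f ε r k (didx r k x) = Lsl f ε r t (didx r t x) ∧
      (∀ k', t ≤ k' → k' < k → ¬ BadC f ε r k' (didx r k' x)) ∧
      (∀ k', t ≤ k' → k' ≤ k → ∀ i, ‖avgS f r k' (didx r k' x) i - Lsl f ε r t (didx r t x) i‖ ≤ ε) := by
  induction k with
  | zero =>
    refine ⟨0, le_rfl, trivial, rfl, fun k' _ h => absurd h (by omega), ?_⟩
    intro k' _ hk' i
    have : k' = 0 := by omega
    subst this
    rw [Lsl]; simp [hε.le]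
  | succ k ih =>
    by_cases h : DTop f ε r (k + 1) (didx r (k + 1) x)
    · refine ⟨k + 1, le_rfl, h, rfl, fun k' _ h => absurd h (by omega), ?_⟩
      intro k' h1 h2 i
      have : k' = k + 1 := by omega
      subst this
      rw [Lsl_of_top f ε r _ _ h]; simp [hε.le]
    · obtain ⟨t, htk, htop, hL, hb, ha⟩ := ih
      have h' := h
      rw [DTop, dpar_didx] at h'
      push Not at h'
      have hL' := Lsl_of_not_top f ε r _ _ h
      rw [dpar_didx] at hL'
      refine ⟨t, by omega, htop, by rw [hL', hL], ?_, ?_⟩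
      · intro k' h1 h2
        rcases Nat.lt_succ_iff_lt_or_eq.mp h2 with h3 | h3
        · exact hb k' h1 h3
        · subst h3; exact h'.1
      · intro k' h1 h2 i
        rcases Nat.lt_or_eq_of_le h2 with h3 | h3
        · exact ha k' h1 (by omega) i
        · subst h3
          rw [← hL]; exact h'.2 i

/-- Non-bad cubes: the averaged slope approximates well. -/
lemma nonbad_approx (f : (Fin n → ℝ) → W) (K : ℝ≥0) (hf : LipschitzWith K f) (ε r : ℝ) (hε : 0 < ε)
    (hr : 0 < r) (k : ℕ) (j : Fin n → ℤ) (hb : ¬ BadC f ε r k j) (L : Fin n → W)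
    (hL : ∀ i, ‖avgS f r k j i - L i‖ ≤ ε) (y y' : Fin n → ℝ) (hy : y ∈ dcube r k j)
    (hyy : ‖y - y'‖ ≤ r / 2 ^ k) :
    ‖f y - f y' - linc L (y - y')‖ ≤ ε * (r / 2 ^ k) + 3 * n * ε * ‖y - y'‖ := by
  rw [BadC] at hb
  push Not at hb
  obtain ⟨x0, hx0, A, hA⟩ := hb
  have h1 := fun i => avgS_consist f K hf ε r hε hr k j x0 hx0 A hA i
  have h2 : ∀ i, ‖A i - L i‖ ≤ 3 * ε := by
    intro i
    have : A i - L i = (avgS f r k j i - L i) - (avgS f r k j i - A i) := by abel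
    rw [this]
    exact (norm_sub_le _ _).trans (by linarith [h1 i, hL i])
  have hd := dcube_norm_lt r hr k j y x0 hy hx0
  have hy1 : y ∈ closedBall x0 (2 * (r / 2 ^ k)) := by
    rw [mem_closedBall, dist_eq_norm]; linarith [norm_nonneg (y - x0)]
  have hy2 : y' ∈ closedBall x0 (2 * (r / 2 ^ k)) := by
    rw [mem_closedBall, dist_eq_norm]
    have : y' - x0 = (y - x0) - (y - y') := by abel
    rw [this]
    exact (norm_sub_le _ _).trans (by linarith)
  have h3 := hA y hy1 y' hy2
  have h4 := linc_norm_le (fun i => A i - L i) (3 * ε) h2 (y - y')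
  rw [linc_sub_left] at h4
  have : f y - f y' - linc L (y - y') = (f y - f y' - linc A (y - y')) + (linc A (y - y') - linc L (y - y')) := by abel
  rw [this]
  refine (norm_add_le _ _).trans ?_
  nlinarith

lemma exists_scale (r d : ℝ) (hr : 0 < r) (t k : ℕ) (h1 : r / 2 ^ k ≤ d) (h2 : d < r / 2 ^ t) :
    ∃ k', t ≤ k' ∧ k' < k ∧ r / 2 ^ (k' + 1) ≤ d ∧ d < r / 2 ^ k' := by
  have mono : ∀ a b : ℕ, a ≤ b → r / 2 ^ b ≤ r / 2 ^ a := by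
    intro a b hab
    apply div_le_div_of_nonneg_left hr.le (by positivity)
    exact pow_le_pow_right₀ (by norm_num) hab
  induction k with
  | zero =>
    exfalso
    have := mono 0 t (by omega)
    linarith
  | succ k ih =>
    by_cases h : r / 2 ^ k ≤ d
    · obtain ⟨k', a, b, c, e⟩ := ih h
      exact ⟨k', a, by omega, c, e⟩
    · push Not at h
      refine ⟨k, ?_, by omega, h1, h⟩
      by_contra hcon
      have := mono (k + 1) t (by omega)
      linarith

lemma tree_prop (f : (Fin n → ℝ) → W) (K : ℝ≥0) (hf : LipschitzWith K f) (ε r : ℝ) (hε : 0 < ε)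
    (hr : 0 < r) (x : Fin n → ℝ) (k : ℕ) :
    ∃ t ≤ k, DTop f ε r t (didx r t x) ∧ (t < k → ¬ BadC f ε r t (didx r t x)) ∧
      ∀ x', r / 2 ^ k ≤ ‖x - x'‖ → ‖x - x'‖ < r / 2 ^ t →
        ‖f x - f x' - linc (Lsl f ε r t (didx r t x)) (x - x')‖ ≤ (3 * n + 2) * ε * ‖x - x'‖ := by
  obtain ⟨t, htk, htop, hL, hb, ha⟩ := tree_raw f ε r hε x k
  refine ⟨t, htk, htop, fun h => hb t le_rfl h, ?_⟩
  intro x' h1 h2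
  obtain ⟨k', a, b, c, d⟩ := exists_scale r _ hr t k h1 h2
  have h3 := nonbad_approx f K hf ε r hε hr k' (didx r k' x) (hb k' a b) _ (ha k' a b.le) x x'
    (dcube_self r k' x) d.le
  refine h3.trans ?_
  have h4 : r / 2 ^ k' = 2 * (r / 2 ^ (k' + 1)) := by rw [pow_succ]; field_simp
  rw [h4]
  nlinarith

lemma top_approx (f : (Fin n → ℝ) → W) (K : ℝ≥0) (hf : LipschitzWith K f) (ε r : ℝ) (hε : 0 < ε)
    (hr : 0 < r) (t : ℕ) (j : Fin n → ℤ) (htop : DTop f ε r t j) (hb : ¬ BadC f ε r t j)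
    (y y' : Fin n → ℝ) (hy : y ∈ dcube r t j) (hy' : y' ∈ dcube r t j) :
    ‖f y - f y' - linc (Lsl f ε r t j) (y - y')‖ ≤ (3 * n + 2) * ε * (r / 2 ^ t) := by
  have h1 := dcube_norm_lt r hr t j y y' hy hy'
  have h2 := nonbad_approx f K hf ε r hε hr t j hb (Lsl f ε r t j)
    (by intro i; rw [Lsl_of_top f ε r t j htop]; simp [hε.le]) y y' hy h1.le
  refine h2.trans ?_
  have h3 : 3 * n * ε * ‖y - y'‖ ≤ 3 * n * ε * (r / 2 ^ t) := by gcongr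
  have h4 : 0 < ε * (r / 2 ^ t) := by positivity
  nlinarith

end

/-- Degenerate cubes. -/
def Deg {n : ℕ} (f : (Fin n → ℝ) → Euc n) (ε η r : ℝ) (t : ℕ) (j : Fin n → ℤ) : Prop :=
  DTop f ε r t j ∧ ¬ BadC f ε r t j ∧ ∃ v : Fin n → ℝ, ‖v‖ = 1 ∧ ‖linc (Lsl f ε r t j) v‖ < 2 * η

/-- Covering of a degenerate image. -/
lemma deg_cover {n : ℕ} (hn : 1 ≤ n) (f : (Fin n → ℝ) → Euc n) (K : ℝ≥0) (p : ℕ) (hp : 0 < p) (l : ℝ) (hl : 0 < l)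
    (Q : Set (Fin n → ℝ)) (hQ : ∀ y ∈ Q, ∀ y' ∈ Q, ‖y - y'‖ ≤ l) (L : Fin n → Euc n) (hL : ∀ i, ‖L i‖ ≤ K)
    (hap : ∀ y ∈ Q, ∀ y' ∈ Q, ‖f y - f y' - linc L (y - y')‖ ≤ l / p)
    (v : Fin n → ℝ) (hv : ‖v‖ = 1) (hLv : ‖linc L v‖ < 2 / p)
    (E : Set (Euc n)) (CE : ℝ) (hCE : 0 ≤ CE)
    (hE : ∀ y ∈ E, ∀ s : ℝ, 0 < s → s ≤ 2 * (n * K + 3) * l →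
      μH[(n : ℝ)] (E ∩ ball y s) ≤ ENNReal.ofReal (CE * s ^ n)) :
    μH[(n : ℝ)] (E ∩ f '' Q) ≤ ENNReal.ofReal (5 ^ (n - 1) * CE * (2 * (n * K + 3)) ^ n / p * l ^ n) := by
  have hpR : (0 : ℝ) < p := by exact_mod_cast hp
  have hp1 : (1 : ℝ) ≤ p := by exact_mod_cast hp
  rcases Q.eq_empty_or_nonempty with rfl | ⟨y0, hy0⟩
  · simp
  obtain ⟨i, hi⟩ : ∃ i, ‖v i‖ = 1 := by
    have : Nonempty (Fin n) := ⟨⟨0, by omega⟩⟩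
    obtain ⟨i, hi⟩ := Finite.exists_max (fun i => ‖v i‖)
    refine ⟨i, le_antisymm (hv ▸ norm_le_pi_norm v i) ?_⟩
    rw [← hv]
    exact (pi_norm_le_iff_of_nonneg (norm_nonneg _)).mpr hi
  have hvi : v i ≠ 0 := by intro h; rw [h] at hi; simp at hi
  -- the reduced vector
  set red : (Fin n → ℝ) → (Fin n → ℝ) := fun w => w - (w i / v i) • v with hred
  have hred_sub : ∀ a b, red (a - b) = red a - red b := by
    intro a b; ext t; simp only [hred, Pi.sub_apply, Pi.smul_apply, smul_eq_mul]; ring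
  have hred_i : ∀ w, red w i = 0 := by
    intro w; simp only [hred, Pi.sub_apply, Pi.smul_apply, smul_eq_mul]; field_simp; ring
  have hcoef : ∀ w : Fin n → ℝ, |w i / v i| ≤ ‖w‖ := by
    intro w
    rw [abs_div, ← Real.norm_eq_abs, ← Real.norm_eq_abs, hi, div_one]; exact norm_le_pi_norm w i
  have hred_n : ∀ w, ‖red w‖ ≤ 2 * ‖w‖ := by
    intro w
    simp only [hred]
    refine (norm_sub_le _ _).trans ?_
    rw [norm_smul, hv, mul_one, Real.norm_eq_abs]
    linarith [hcoef w]
  set Φ : (Fin n → ℝ) → (Fin n → ℤ) := fun y t => ⌊red (y - y0) t / (l / p)⌋ with hΦ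
  set D : ℝ := (n * K + 3) * (l / p) with hD
  have hDpos : 0 < D := by positivity
  have hdist : ∀ y ∈ Q, ∀ y' ∈ Q, Φ y = Φ y' → ‖f y - f y'‖ ≤ D := by
    intro y hy y' hy' hyy
    have hq : ‖red (y - y')‖ ≤ l / p := by
      rw [pi_norm_le_iff_of_nonneg (by positivity)]
      intro t
      have e1 : y - y' = (y - y0) - (y' - y0) := by abel
      rw [e1, hred_sub, Pi.sub_apply]
      have e2 := congrFun hyy t
      simp only [hΦ] at e2
      have e3 := Int.abs_sub_lt_one_of_floor_eq_floor e2
      rw [← sub_div, abs_div, abs_of_pos (by positivity : 0 < l / p), div_lt_one (by positivity)] at e3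
      exact e3.le
    have e4 : y - y' = red (y - y') + ((y - y') i / v i) • v := by simp [hred]
    have e5 : ‖linc L (y - y')‖ ≤ n * K * (l / p) + l * (2 / p) := by
      rw [e4, linc_add, linc_smul]
      refine (norm_add_le _ _).trans ?_
      rw [norm_smul, Real.norm_eq_abs]
      have a1 := linc_norm_le L K hL (red (y - y'))
      have a2 : (n : ℝ) * K * ‖red (y - y')‖ ≤ n * K * (l / p) := by gcongr
      have a3 : |(y - y') i / v i| * ‖linc L v‖ ≤ l * (2 / p) := by
        have := hcoef (y - y')
        have b := hQ y hy y' hy'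
        have c : |(y - y') i / v i| ≤ l := by linarith
        exact mul_le_mul c hLv.le (norm_nonneg _) hl.le
      linarith
    have e6 : f y - f y' = (f y - f y' - linc L (y - y')) + linc L (y - y') := by abel
    rw [e6]
    refine (norm_add_le _ _).trans ?_
    have e7 := hap y hy y' hy'
    have : D = n * K * (l / p) + l * (2 / p) + l / p := by rw [hD]; ring
    linarith
  classical
  set I : Fin n → Finset ℤ := fun t => if t = i then {0} else Finset.Icc (-(2 * p : ℤ)) (2 * p) with hI
  set J : Finset (Fin n → ℤ) := Fintype.piFinset I with hJ
  have hmemJ : ∀ y ∈ Q, Φ y ∈ J := by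
    intro y hy
    rw [hJ, Fintype.mem_piFinset]
    intro t
    by_cases hti : t = i
    · subst hti
      simp [hI, hΦ, hred_i]
    · simp only [hI, hti, if_false, Finset.mem_Icc, hΦ]
      have a1 : |red (y - y0) t| ≤ 2 * l := by
        have b1 := norm_le_pi_norm (red (y - y0)) t
        have b2 := hred_n (y - y0)
        have b3 := hQ y hy y0 hy0
        rw [Real.norm_eq_abs] at b1
        linarith
      rw [abs_le] at a1
      have a2 : red (y - y0) t / (l / p) = red (y - y0) t * p / l := by field_simp
      rw [a2]
      constructor
      · rw [Int.le_floor, le_div_iff₀ hl]; push_cast; nlinarith [a1.1]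
      · have : red (y - y0) t * p / l ≤ ((2 * p : ℤ) : ℝ) := by
          rw [div_le_iff₀ hl]; push_cast; nlinarith [a1.2]
        have h2 := Int.floor_mono this
        rwa [Int.floor_intCast] at h2
  have hJc : (J.card : ℝ) ≤ (5 * p) ^ (n - 1) := by
    rw [hJ, Fintype.card_piFinset, ← Finset.mul_prod_erase Finset.univ _ (Finset.mem_univ i)]
    have a1 : (I i).card = 1 := by simp [hI]
    have a2 : ∀ t ∈ Finset.univ.erase i, (I t).card = 4 * p + 1 := by
      intro t ht
      have := Finset.ne_of_mem_erase ht
      simp only [hI, this, if_false, Int.card_Icc]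
      omega
    rw [a1, Finset.prod_congr rfl a2]
    simp only [Finset.prod_const, Finset.card_erase_of_mem (Finset.mem_univ i), Finset.card_univ, Fintype.card_fin, one_mul]
    push_cast
    gcongr
    linarith
  have hcov : E ∩ f '' Q ⊆ ⋃ c ∈ J, E ∩ f '' {y ∈ Q | Φ y = c} := by
    rintro _ ⟨hz, y, hy, rfl⟩
    simp only [mem_iUnion]
    exact ⟨Φ y, hmemJ y hy, hz, y, ⟨hy, rfl⟩, rfl⟩
  have hpiece : ∀ c ∈ J, μH[(n : ℝ)] (E ∩ f '' {y ∈ Q | Φ y = c}) ≤ ENNReal.ofReal (CE * (2 * D) ^ n) := by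
    intro c _
    rcases (E ∩ f '' {y ∈ Q | Φ y = c}).eq_empty_or_nonempty with h0 | ⟨z, hzE, y, ⟨hy, hyc⟩, rfl⟩
    · rw [h0]; simp
    · refine le_trans (measure_mono ?_) (hE (f y) hzE (2 * D) (by positivity) ?_)
      · rintro _ ⟨hz', y', ⟨hy', hyc'⟩, rfl⟩
        refine ⟨hz', ?_⟩
        rw [mem_ball, dist_eq_norm]
        have := hdist y' hy' y hy (by rw [hyc, hyc'])
        linarith
      · have : l / p ≤ l := div_le_self hl.le hp1
        rw [hD, mul_assoc]
        gcongr
  calc _ ≤ ∑ c ∈ J, μH[(n : ℝ)] (E ∩ f '' {y ∈ Q | Φ y = c}) :=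
        (measure_mono hcov).trans (measure_biUnion_finset_le _ _)
    _ ≤ ∑ c ∈ J, ENNReal.ofReal (CE * (2 * D) ^ n) := Finset.sum_le_sum hpiece
    _ = ENNReal.ofReal (J.card * (CE * (2 * D) ^ n)) := by
        rw [Finset.sum_const, nsmul_eq_mul, ENNReal.ofReal_mul (p := (J.card : ℝ)) (by positivity), ENNReal.ofReal_natCast]
    _ ≤ _ := by
        apply ENNReal.ofReal_le_ofReal
        calc (J.card : ℝ) * (CE * (2 * D) ^ n) ≤ (5 * p) ^ (n - 1) * (CE * (2 * D) ^ n) := by gcongr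
          _ = _ := by
            obtain ⟨m, rfl⟩ : ∃ m, n = m + 1 := ⟨n - 1, by omega⟩
            rw [hD]
            simp only [Nat.add_sub_cancel]
            generalize ((m + 1 : ℕ) : ℝ) * (K : ℝ) + 3 = a
            have e : (2 * (a * (l / p))) = (2 * a) * l / p := by ring
            rw [e, div_pow, mul_pow (2 * a) l, mul_pow (5 : ℝ), pow_succ (p : ℝ) m]
            field_simp

lemma graph_ext (n : ℕ) (P : Submodule ℝ (Euc n)) (hP : Module.finrank ℝ P = n) (S : Set (Euc n))
    (hS : ∀ a ∈ S, ∀ b ∈ S, ‖Pᗮ.orthogonalProjectionOnto (a - b)‖ ≤ ‖P.orthogonalProjectionOnto (a - b)‖) :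
    ∃ Γ, IsLipschitzGraph n 1 Γ ∧ S ⊆ Γ := by
  have h1 : Module.finrank ℝ Pᗮ = 1 := by
    have := Submodule.finrank_add_finrank_orthogonal P
    rw [hP, finrank_euclideanSpace, Fintype.card_fin] at this
    omega
  let e := (stdOrthonormalBasis ℝ Pᗮ).repr
  have e1 : Unique (Fin (Module.finrank ℝ Pᗮ)) := by rw [h1]; infer_instance
  let u : Pᗮ := stdOrthonormalBasis ℝ Pᗮ default
  have hu : ‖u‖ = 1 := (stdOrthonormalBasis ℝ Pᗮ).norm_eq_one _
  have hw : ∀ w : Pᗮ, w = inner ℝ u w • u := by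
    intro w
    have := (stdOrthonormalBasis ℝ Pᗮ).sum_repr' w
    rw [Fintype.sum_unique] at this
    exact this.symm
  have hwn : ∀ w : Pᗮ, ‖w‖ = |inner ℝ u w| := by
    intro w
    conv_lhs => rw [hw w]
    rw [norm_smul, hu, mul_one, Real.norm_eq_abs]
  classical
  let g0 : P → ℝ := fun p => inner ℝ u (Pᗮ.orthogonalProjection
    (Function.invFunOn (fun a => P.orthogonalProjectionOnto a) S p))
  have hg0 : ∀ a ∈ S, g0 (P.orthogonalProjectionOnto a) = inner ℝ u (Pᗮ.orthogonalProjectionOnto a) := by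
    intro a ha
    have hm : P.orthogonalProjectionOnto a ∈ (fun a => P.orthogonalProjectionOnto a) '' S := ⟨a, ha, rfl⟩
    have m1 := Function.invFunOn_mem hm
    have m2 := Function.invFunOn_eq hm
    have := hS _ m1 a ha
    rw [map_sub, map_sub, m2, sub_self, norm_zero] at this
    have h0 : _ = _ := sub_eq_zero.mp (norm_le_zero_iff.mp this)
    simp only [g0]
    rw [h0]
  have hL : LipschitzOnWith 1 g0 ((fun a => P.orthogonalProjectionOnto a) '' S) := by
    apply LipschitzOnWith.of_dist_le_mul
    rintro _ ⟨a, ha, rfl⟩ _ ⟨b, hb, rfl⟩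
    simp only
    rw [hg0 a ha, hg0 b hb, Real.dist_eq, ← inner_sub_right, ← map_sub, ← hwn, dist_eq_norm, ← map_sub]
    simpa using hS a ha b hb
  obtain ⟨g, hg, hgg⟩ := hL.extend_real
  refine ⟨_, ⟨P, hP, fun p => g p • u, ?_, rfl⟩, ?_⟩
  · apply LipschitzWith.of_dist_le_mul
    intro p q
    rw [dist_eq_norm, ← sub_smul, norm_smul, hu, mul_one, ← dist_eq_norm]
    exact hg.dist_le_mul p q
  · intro a ha
    refine ⟨P.orthogonalProjectionOnto a, ?_⟩
    have hh : g (P.orthogonalProjectionOnto a) = inner ℝ u (Pᗮ.orthogonalProjectionOnto a) := by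
      rw [← hg0 a ha]; exact (hgg ⟨a, ha, rfl⟩).symm
    simp only [hh]
    rw [← hw]
    have := P.starProjection_add_starProjection_orthogonal a
    exact this.symm

lemma exists_plane (n : ℕ) : ∃ P : Submodule ℝ (Euc n), Module.finrank ℝ P = n := by
  obtain ⟨f, hf⟩ := exists_linearIndependent_of_le_finrank (R := ℝ) (M := Euc n) (n := n)
    (by rw [finrank_euclideanSpace, Fintype.card_fin]; omega)
  refine ⟨Submodule.span ℝ (range f), ?_⟩
  rw [finrank_span_eq_card hf, Fintype.card_fin]

lemma graph_point (n : ℕ) (z : Euc n) : ∃ Γ, IsLipschitzGraph n 1 Γ ∧ z ∈ Γ := by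
  obtain ⟨P, hP⟩ := exists_plane n
  obtain ⟨Γ, h, h2⟩ := graph_ext n P hP {z} (by
    intro a ha b hb
    rw [mem_singleton_iff.mp ha, mem_singleton_iff.mp hb]; simp)
  exact ⟨Γ, h, h2 rfl⟩

lemma graph_max {n : ℕ} (f : (Fin n → ℝ) → Euc n) (K : ℝ≥0) (hf : LipschitzWith K f) (η : ℝ) (hη : 0 < η)
    (L : Fin n → Euc n) (hL : ∀ v, 2 * η * ‖v‖ ≤ ‖linc L v‖) (Q : Set (Fin n → ℝ)) (hQ : Q.Nonempty) :
    ∃ Γ, IsLipschitzGraph n 1 Γ ∧ (∃ x ∈ Q, f x ∈ Γ) ∧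
      ∀ x ∈ Q, ∀ d : ℝ, 0 < d → (∀ x' ∈ Q, d ≤ ‖x - x'‖ → ‖f x - f x' - linc L (x - x')‖ ≤ η * ‖x - x'‖) →
        ∃ x' ∈ Q, f x' ∈ Γ ∧ ‖x - x'‖ < d := by
  have hz := zorn_subset {X : Set (Fin n → ℝ) | X ⊆ Q ∧ ∀ x ∈ X, ∀ x' ∈ X, ‖f x - f x' - linc L (x - x')‖ ≤ η * ‖x - x'‖} (by
    intro c hc hch
    refine ⟨⋃₀ c, ⟨?_, ?_⟩, fun s hs => subset_sUnion_of_mem hs⟩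
    · exact sUnion_subset fun s hs => (hc hs).1
    · rintro x ⟨s, hs, hx⟩ x' ⟨s', hs', hx'⟩
      rcases hch.total hs hs' with h | h
      · exact (hc hs').2 x (h hx) x' hx'
      · exact (hc hs).2 x hx x' (h hx'))
  obtain ⟨X, ⟨hXQ, hXL⟩, hmax⟩ := hz
  have key : ∀ x ∈ Q, ∀ d : ℝ, 0 < d → (∀ x' ∈ Q, d ≤ ‖x - x'‖ → ‖f x - f x' - linc L (x - x')‖ ≤ η * ‖x - x'‖) →
        ∃ x' ∈ X, ‖x - x'‖ < d := by
    intro x hx d hd hx2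
    by_contra hcon
    push Not at hcon
    have hsub : insert x X ⊆ X := by
      apply hmax
      · refine ⟨insert_subset hx hXQ, ?_⟩
        rintro a (rfl | ha) b (rfl | hb)
        · rw [sub_self, sub_self, zero_sub, norm_neg]
          simp [linc]
        · exact hx2 b (hXQ hb) (hcon b hb)
        · have := hx2 a (hXQ ha) (hcon a ha)
          have e : f a - f b - linc L (a - b) = - (f b - f a - linc L (b - a)) := by
            rw [linc_sub, linc_sub]; abel
          rw [e, norm_neg, norm_sub_rev a b]; exact this
        · exact hXL a ha b hb
      · exact subset_insert _ _
    have := hcon x (hsub (mem_insert _ _))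
    rw [sub_self, norm_zero] at this
    linarith
  have hXne : X.Nonempty := by
    obtain ⟨x, hx⟩ := hQ
    by_contra hcon
    rw [not_nonempty_iff_eq_empty] at hcon
    have hsub : ({x} : Set (Fin n → ℝ)) ⊆ X := by
      apply hmax
      · refine ⟨singleton_subset_iff.mpr hx, ?_⟩
        rintro a rfl b rfl
        rw [sub_self, sub_self, zero_sub, norm_neg]
        simp [linc]
      · rw [hcon]; exact empty_subset _
    rw [hcon] at hsub
    exact hsub rfl
  let A : (Fin n → ℝ) →ₗ[ℝ] Euc n := Fintype.linearCombination ℝ L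
  have hA : ∀ v, A v = linc L v := fun v => by simp [A, Fintype.linearCombination_apply, linc]
  let P : Submodule ℝ (Euc n) := LinearMap.range A
  have hP : Module.finrank ℝ P = n := by
    have hinj : Function.Injective A := by
      rw [injective_iff_map_eq_zero]
      intro v hv
      have := hL v
      rw [← hA, hv, norm_zero] at this
      have h2 : ‖v‖ ≤ 0 := by nlinarith [norm_nonneg v]
      exact norm_le_zero_iff.mp h2
    rw [LinearMap.finrank_range_of_inj hinj]; simp
  obtain ⟨Γ, hΓ, hsub⟩ := graph_ext n P hP (f '' X) (by
    rintro _ ⟨x, hx, rfl⟩ _ ⟨x', hx', rfl⟩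
    have h := hXL x hx x' hx'
    set v := x - x'
    set w := f x - f x' - linc L v with hw
    have hd : f x - f x' = linc L v + w := by rw [hw]; abel
    have hmem : linc L v ∈ P := by rw [← hA]; exact LinearMap.mem_range_self A v
    rw [hd, map_add, map_add]
    have e1 : Pᗮ.orthogonalProjectionOnto (linc L v) = 0 := by
      rw [Submodule.orthogonalProjectionOnto_eq_zero_iff, Submodule.orthogonal_orthogonal]; exact hmem
    have e2 : ‖P.orthogonalProjectionOnto (linc L v)‖ = ‖linc L v‖ := by
      have := P.orthogonalProjectionOnto_mem_subspace_eq_self ⟨linc L v, hmem⟩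
      simp only at this
      rw [this]; rfl
    have e3 : ‖Pᗮ.orthogonalProjectionOnto w‖ ≤ ‖w‖ := Submodule.norm_orthogonalProjectionOnto_apply_le _ _
    have e4 : ‖P.orthogonalProjectionOnto w‖ ≤ ‖w‖ := Submodule.norm_orthogonalProjectionOnto_apply_le _ _
    rw [e1, zero_add]
    have e5 := norm_sub_le_norm_add (P.orthogonalProjectionOnto (linc L v)) (P.orthogonalProjectionOnto w)
    have := hL v
    rw [e2] at e5
    linarith)
  refine ⟨Γ, hΓ, ?_, ?_⟩
  · obtain ⟨x, hx⟩ := hXne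
    exact ⟨x, hXQ hx, hsub ⟨x, hx, rfl⟩⟩
  · intro x hx d hd hx2
    obtain ⟨x', h1, h2⟩ := key x hx d hd hx2
    exact ⟨x', hXQ h1, hsub ⟨x', h1, rfl⟩, h2⟩

lemma didx_le {n : ℕ} (r : ℝ) (k m : ℕ) (h : k ≤ m) (x y : Fin n → ℝ) (hxy : didx r m x = didx r m y) :
    didx r k x = didx r k y := by
  induction m with
  | zero =>
    have : k = 0 := by omega
    subst this; exact hxy
  | succ m ih =>
    rcases Nat.lt_or_eq_of_le h with h1 | h1
    · apply ih (by omega)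
      rw [← dpar_didx r m x, ← dpar_didx r m y, hxy]
    · subst h1; exact hxy

lemma dcube_nonempty {n : ℕ} (r : ℝ) (hr : 0 < r) (k : ℕ) (j : Fin n → ℤ) : (dcube r k j).Nonempty := by
  apply nonempty_of_measure_ne_zero (μ := volume)
  rw [dcube_volume r hr]
  have : 0 < (r / 2 ^ k) ^ n := by positivity
  simpa using this

lemma lin_lower {n : ℕ} (L : Fin n → Euc n) (η : ℝ) (h : ∀ v : Fin n → ℝ, ‖v‖ = 1 → 2 * η ≤ ‖linc L v‖)
    (v : Fin n → ℝ) : 2 * η * ‖v‖ ≤ ‖linc L v‖ := by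
  by_cases hv : v = 0
  · subst hv; simp [linc]
  · have hv' : 0 < ‖v‖ := norm_pos_iff.mpr hv
    have h1 := h (‖v‖⁻¹ • v) (by rw [norm_smul, norm_inv, norm_norm, inv_mul_cancel₀ hv'.ne'])
    rw [linc_smul, norm_smul, norm_inv, norm_norm, ← div_eq_inv_mul, le_div_iff₀ hv'] at h1
    exact h1

lemma piece_top {n : ℕ} (f : (Fin n → ℝ) → Euc n) (K : ℝ≥0) (hf : LipschitzWith K f) (ε η r : ℝ)
    (hη : 0 < η) (hr : 0 < r) (t : ℕ) (j : Fin n → ℤ) (htop : DTop f ε r t j) :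
    ∃ Γ, IsLipschitzGraph n 1 Γ ∧ (∃ x ∈ dcube r t j, f x ∈ Γ) ∧
      ∀ x ∈ dcube r t j, ¬ Deg f ε η r t j → ∀ k, t ≤ k → (t < k → ¬ BadC f ε r t j) →
        (∀ x', r / 2 ^ k ≤ ‖x - x'‖ → ‖x - x'‖ < r / 2 ^ t →
          ‖f x - f x' - linc (Lsl f ε r t j) (x - x')‖ ≤ η * ‖x - x'‖) →
        ∃ z ∈ Γ, dist (f x) z ≤ K * (r / 2 ^ k) := by
  by_cases hb : BadC f ε r t j
  · obtain ⟨x0, hx0⟩ := dcube_nonempty r hr t j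
    obtain ⟨Γ, hΓ, hz⟩ := graph_point n (f x0)
    refine ⟨Γ, hΓ, ⟨x0, hx0, hz⟩, ?_⟩
    intro x hx _ k htk hk _
    have : t = k := by
      by_contra hne
      exact hk (by omega) hb
    subst this
    refine ⟨f x0, hz, ?_⟩
    refine (hf.dist_le_mul _ _).trans ?_
    gcongr
    rw [dist_eq_norm]
    exact (dcube_norm_lt r hr t j x x0 hx hx0).le
  · by_cases hd : Deg f ε η r t j
    · obtain ⟨x0, hx0⟩ := dcube_nonempty r hr t j
      obtain ⟨Γ, hΓ, hz⟩ := graph_point n (f x0)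
      exact ⟨Γ, hΓ, ⟨x0, hx0, hz⟩, fun x hx h => absurd hd h⟩
    · have hL : ∀ v : Fin n → ℝ, ‖v‖ = 1 → 2 * η ≤ ‖linc (Lsl f ε r t j) v‖ := by
        intro v hv
        by_contra hcon
        push Not at hcon
        exact hd ⟨htop, hb, v, hv, hcon⟩
      obtain ⟨Γ, hΓ, hz, hmax⟩ := graph_max f K hf η hη _ (lin_lower _ η hL) (dcube r t j) (dcube_nonempty r hr t j)
      refine ⟨Γ, hΓ, hz, ?_⟩
      intro x hx _ k htk hk hap
      obtain ⟨x', hx', hΓx, hlt⟩ := hmax x hx (r / 2 ^ k) (by positivity) (by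
        intro x' hx' h1
        exact hap x' h1 (dcube_norm_lt r hr t j x x' hx hx'))
      refine ⟨f x', hΓx, ?_⟩
      refine (hf.dist_le_mul _ _).trans ?_
      gcongr
      rw [dist_eq_norm]
      exact hlt.le

lemma top_index_sum {n : ℕ} (f : (Fin n → ℝ) → Euc n) (ε r : ℝ) (hr : 0 < r) :
    ∑' T : {p : ℕ × (Fin n → ℤ) // DTop f ε r p.1 p.2 ∧ (dpar)^[p.1] p.2 = 0}, ENNReal.ofReal ((r / 2 ^ T.1.1) ^ n) ≤
      ∑' k : ℕ, volume {x ∈ dcube r 0 (0 : Fin n → ℤ) | DTop f ε r k (didx r k x)} := by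
  classical
  have h1 : ∑' T : {p : ℕ × (Fin n → ℤ) // DTop f ε r p.1 p.2 ∧ (dpar)^[p.1] p.2 = 0}, ENNReal.ofReal ((r / 2 ^ T.1.1) ^ n)
    = ∑' p : ℕ × (Fin n → ℤ), indicator {p : ℕ × (Fin n → ℤ) | DTop f ε r p.1 p.2 ∧ (dpar)^[p.1] p.2 = 0}
      (fun p => ENNReal.ofReal ((r / 2 ^ p.1) ^ n)) p := tsum_subtype {p : ℕ × (Fin n → ℤ) | DTop f ε r p.1 p.2 ∧ (dpar)^[p.1] p.2 = 0} (fun p => ENNReal.ofReal ((r / 2 ^ p.1) ^ n))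
  rw [h1, ENNReal.tsum_prod']
  apply ENNReal.tsum_le_tsum
  intro k
  have hm : MeasurableSet {x ∈ dcube r 0 (0 : Fin n → ℤ) | DTop f ε r k (didx r k x)} :=
    (dcube_measurable r hr 0 0).inter
      (didx_measurable r k (MeasurableSet.of_discrete : MeasurableSet {j : Fin n → ℤ | DTop f ε r k j}))
  rw [← setLIntegral_one, dcube_iUnion_lintegral r hr k _ hm]
  apply ENNReal.tsum_le_tsum
  intro j
  by_cases h : DTop f ε r k j ∧ (dpar)^[k] j = 0
  · rw [indicator_of_mem (by exact h), ← dcube_volume r hr, setLIntegral_one]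
    apply measure_mono
    intro x hx
    have hx' : didx r k x = j := hx
    refine ⟨⟨?_, by rw [hx']; exact h.1⟩, hx⟩
    show didx r 0 x = 0
    rw [didx_zero r k x, hx']; exact h.2
  · rw [indicator_of_notMem (by exact h)]; exact zero_le

lemma deg_measure {n : ℕ} (hn : 1 ≤ n) (f : (Fin n → ℝ) → Euc n) (K : ℝ≥0) (hf : LipschitzWith K f) (p : ℕ) (hp : 0 < p)
    (ε : ℝ) (hε : ε = 1 / ((3 * n + 2) * p)) (r : ℝ) (hr : 0 < r)
    (E : Set (Euc n)) (CE : ℝ) (hCE : 0 ≤ CE)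
    (hE : ∀ y ∈ E, ∀ s : ℝ, 0 < s → s ≤ 2 * (n * K + 3) * r →
      μH[(n : ℝ)] (E ∩ ball y s) ≤ ENNReal.ofReal (CE * s ^ n)) :
    μH[(n : ℝ)] (E ∩ f '' {x ∈ dcube r 0 (0 : Fin n → ℤ) | ∃ t, Deg f ε (1 / p) r t (didx r t x)}) ≤
      ENNReal.ofReal (5 ^ (n - 1) * CE * (2 * (n * K + 3)) ^ n / p * r ^ n) := by
  have hpR : (0 : ℝ) < p := by exact_mod_cast hp
  have hε0 : 0 < ε := by rw [hε]; positivity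
  set A : ℝ := 5 ^ (n - 1) * CE * (2 * (n * K + 3)) ^ n / p with hA
  have hA0 : 0 ≤ A := by positivity
  set Z : ℕ → Set (Fin n → ℝ) := fun t => {x ∈ dcube r 0 (0 : Fin n → ℤ) |
    Deg f ε (1 / p) r t (didx r t x) ∧ ∀ t' < t, ¬ Deg f ε (1 / p) r t' (didx r t' x)} with hZ
  have hcov : {x ∈ dcube r 0 (0 : Fin n → ℤ) | ∃ t, Deg f ε (1 / p) r t (didx r t x)} ⊆ ⋃ t, Z t := by
    rintro x ⟨hx, h⟩
    classical
    exact mem_iUnion.mpr ⟨Nat.find h, hx, Nat.find_spec h, fun t' ht' => Nat.find_min h ht'⟩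
  have hZm : ∀ t, MeasurableSet (Z t) := by
    intro t
    refine (dcube_measurable r hr 0 0).inter (MeasurableSet.inter ?_ ?_)
    · exact (didx_measurable r t (MeasurableSet.of_discrete : MeasurableSet {j : Fin n → ℤ | Deg f ε (1 / p) r t j}))
    · have : {x | ∀ t' < t, ¬ Deg f ε (1 / p) r t' (didx r t' x)} =
        ⋂ t', ⋂ (_ : t' < t), didx r t' ⁻¹' {j : Fin n → ℤ | ¬ Deg f ε (1 / p) r t' j} := by
        ext x; simp
      change MeasurableSet {x | ∀ t' < t, ¬ Deg f ε (1 / p) r t' (didx r t' x)}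
      rw [this]
      exact MeasurableSet.iInter fun t' => MeasurableSet.iInter fun _ =>
        didx_measurable r t' (MeasurableSet.of_discrete)
  have hdisj : Pairwise (Function.onFun Disjoint Z) := by
    intro s t hst
    rw [Function.onFun, disjoint_left]
    rintro x ⟨_, h1, h2⟩ ⟨_, h3, h4⟩
    rcases lt_or_gt_of_ne hst with h | h
    · exact h4 s h h1
    · exact h2 t h h3
  have hpiece : ∀ t j, μH[(n : ℝ)] (E ∩ f '' (Z t ∩ dcube r t j)) ≤ ENNReal.ofReal A * volume (Z t ∩ dcube r t j) := by
    intro t j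
    rcases (Z t ∩ dcube r t j).eq_empty_or_nonempty with h0 | ⟨x, ⟨hx0, hxd, hxm⟩, hxj⟩
    · rw [h0]; simp
    have hxj' : didx r t x = j := hxj
    have hsub : dcube r t j ⊆ Z t := by
      intro y hy
      have hy' : didx r t y = didx r t x := by rw [hxj']; exact hy
      refine ⟨?_, by rw [hy']; exact hxd, ?_⟩
      · have := didx_le r 0 t (by omega) y x hy'
        exact this.trans hx0
      · intro t' ht'
        rw [didx_le r t' t ht'.le y x hy']; exact hxm t' ht'
    rw [inter_eq_right.mpr hsub, dcube_volume r hr, ← ENNReal.ofReal_mul hA0, hA]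
    rw [hxj'] at hxd
    obtain ⟨htop, hb, v, hv, hLv⟩ := hxd
    refine deg_cover hn f K p hp (r / 2 ^ t) (by positivity) _
      (fun y hy y' hy' => (dcube_norm_lt r hr t j y y' hy hy').le) (Lsl f ε r t j)
      (fun i => Lsl_norm_le f K hf ε r hr t j i) ?_ v hv (by rw [mul_one_div] at hLv; exact hLv) E CE hCE ?_
    · intro y hy y' hy'
      refine (top_approx f K hf ε r hε0 hr t j htop hb y y' hy hy').trans (le_of_eq ?_)
      rw [hε]; field_simp
    · intro y hy s hs hs2
      refine hE y hy s hs (hs2.trans ?_)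
      gcongr
      exact div_le_self hr.le (one_le_pow₀ (by norm_num))
  have hZt : ∀ t, μH[(n : ℝ)] (E ∩ f '' (Z t)) ≤ ENNReal.ofReal A * volume (Z t) := by
    intro t
    have e1 : E ∩ f '' (Z t) ⊆ ⋃ j, E ∩ f '' (Z t ∩ dcube r t j) := by
      rintro _ ⟨hy, x, hx, rfl⟩
      exact mem_iUnion.mpr ⟨didx r t x, hy, x, ⟨hx, dcube_self r t x⟩, rfl⟩
    refine (measure_mono e1).trans ((measure_iUnion_le _).trans ?_)
    refine (ENNReal.tsum_le_tsum (hpiece t)).trans ?_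
    rw [ENNReal.tsum_mul_left]
    gcongr
    have := dcube_iUnion_lintegral r hr t (Z t) (hZm t) 1
    simp only [Pi.one_apply, setLIntegral_one] at this
    rw [this]
  have e2 : E ∩ f '' {x ∈ dcube r 0 (0 : Fin n → ℤ) | ∃ t, Deg f ε (1 / p) r t (didx r t x)} ⊆ ⋃ t, E ∩ f '' (Z t) := by
    rintro _ ⟨hy, x, hx, rfl⟩
    obtain ⟨t, ht⟩ := mem_iUnion.mp (hcov hx)
    exact mem_iUnion.mpr ⟨t, hy, x, ht, rfl⟩
  refine (measure_mono e2).trans ((measure_iUnion_le _).trans ?_)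
  refine (ENNReal.tsum_le_tsum hZt).trans ?_
  rw [ENNReal.tsum_mul_left, ← measure_iUnion hdisj hZm, ENNReal.ofReal_mul hA0]
  gcongr
  have : ⋃ t, Z t ⊆ dcube r 0 (0 : Fin n → ℤ) := iUnion_subset fun t x hx => hx.1
  refine (measure_mono this).trans ?_
  rw [dcube_volume r hr]; simp

lemma good_family (n : ℕ) (hn : 1 ≤ n) (K : ℝ≥0) (CE δ : ℝ) (hCE : 0 ≤ CE) (hδ : 0 < δ) :
    ∃ C : ℝ, 0 ≤ C ∧ ∀ f : (Fin n → ℝ) → Euc n, LipschitzWith K f → ∀ r : ℝ, 0 < r → ∀ E : Set (Euc n),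
      (∀ y ∈ E, ∀ s : ℝ, 0 < s → s ≤ 2 * (n * K + 3) * r →
        μH[(n : ℝ)] (E ∩ ball y s) ≤ ENNReal.ofReal (CE * s ^ n)) →
      ∃ (ι : Type) (_ : Countable ι) (l : ι → ℝ) (z : ι → Euc n) (Γ : ι → Set (Euc n)) (F : Set (Fin n → ℝ)),
        (∀ T, 0 < l T) ∧ (∀ T, l T ≤ r) ∧ (∀ T, IsLipschitzGraph n 1 (Γ T)) ∧ (∀ T, z T ∈ Γ T) ∧
        (∀ T, z T ∈ f '' dcube r 0 0) ∧
        ∑' T, ENNReal.ofReal (l T ^ n) ≤ ENNReal.ofReal (C * r ^ n) ∧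
        μH[(n : ℝ)] (E ∩ f '' (dcube r 0 0 \ F)) ≤ ENNReal.ofReal (δ * r ^ n) ∧
        ∀ x ∈ F, x ∈ dcube r 0 0 ∧ ∀ s : ℝ, 0 < s → s ≤ r → ∃ T, dist (f x) (z T) ≤ K * l T ∧ s ≤ 2 * l T ∧
          ∃ z' ∈ Γ T, dist (f x) z' ≤ K * s := by
  set C' : ℝ := 5 ^ (n - 1) * CE * (2 * (n * K + 3)) ^ n with hC'
  obtain ⟨p, hp⟩ := exists_nat_gt (C' / δ)
  have hC'0 : 0 ≤ C' := by positivity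
  have hp0 : 0 < p := by
    have : (0 : ℝ) < p := lt_of_le_of_lt (by positivity) hp
    exact_mod_cast this
  have hpR : (0 : ℝ) < p := by exact_mod_cast hp0
  set ε : ℝ := 1 / ((3 * n + 2) * p) with hε
  have hε0 : 0 < ε := by positivity
  obtain ⟨C, hC0, hC⟩ := top_sum n (Euc n) K ε hε0
  refine ⟨C, hC0, ?_⟩
  intro f hf r hr E hE
  have hη : (0 : ℝ) < 1 / p := by positivity
  choose! Γ hΓ1 hΓ2 hΓ3 using fun (t : ℕ) (j : Fin n → ℤ) => piece_top f K hf ε (1 / p) r hη hr t j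
  choose! x0 hx0 hx0Γ using hΓ2
  refine ⟨{p : ℕ × (Fin n → ℤ) // DTop f ε r p.1 p.2 ∧ (dpar)^[p.1] p.2 = 0}, inferInstance,
    fun T => r / 2 ^ T.1.1, fun T => f (x0 T.1.1 T.1.2), fun T => Γ T.1.1 T.1.2,
    {x ∈ dcube r 0 (0 : Fin n → ℤ) | ∀ t, ¬ Deg f ε (1 / p) r t (didx r t x)}, ?_, ?_, ?_, ?_, ?_, ?_, ?_, ?_⟩
  · intro T; positivity
  · intro T; exact div_le_self hr.le (one_le_pow₀ (by norm_num))
  · intro T; exact hΓ1 _ _ T.2.1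
  · intro T; exact hx0Γ _ _ T.2.1
  · intro T
    refine ⟨_, ?_, rfl⟩
    have : didx r T.1.1 (x0 T.1.1 T.1.2) = T.1.2 := hx0 _ _ T.2.1
    show didx r 0 _ = 0
    rw [didx_zero r T.1.1, this]; exact T.2.2
  · exact (top_index_sum f ε r hr).trans (hC f hf r hr)
  · have h := deg_measure hn f K hf p hp0 ε hε r hr E CE hCE hE
    refine le_trans (measure_mono ?_) (h.trans ?_)
    · gcongr
      rintro x ⟨h1, h2⟩
      refine ⟨h1, ?_⟩
      by_contra hcon
      push Not at hcon
      exact h2 ⟨h1, hcon⟩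
    · apply ENNReal.ofReal_le_ofReal
      gcongr
      rw [div_lt_iff₀ hδ] at hp
      rw [div_le_iff₀ hpR]
      linarith
  · rintro x ⟨hxQ, hxd⟩
    refine ⟨hxQ, ?_⟩
    intro s hs hsr
    obtain ⟨k, hk1, hk2⟩ := exists_nat_pow_near (x := r / s) (y := 2) ((one_le_div hs).mpr hsr) (by norm_num)
    rw [le_div_iff₀ hs] at hk1
    rw [div_lt_iff₀ hs] at hk2
    have hk3 : s ≤ 2 * (r / 2 ^ (k + 1)) := by
      rw [pow_succ, mul_div_assoc', le_div_iff₀ (by positivity)]; linarith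
    have hk4 : r / 2 ^ (k + 1) ≤ s := by
      rw [div_le_iff₀ (by positivity)]; linarith
    obtain ⟨t, htk, htop, hnb, hap⟩ := tree_prop f K hf ε r hε0 hr x (k + 1)
    have hroot : (dpar)^[t] (didx r t x) = 0 := by rw [← didx_zero r t x]; exact hxQ
    have hεη : (3 * n + 2) * ε = 1 / (p : ℝ) := by rw [hε]; field_simp
    rw [hεη] at hap
    obtain ⟨z', hz', hd⟩ := hΓ3 t (didx r t x) htop x (dcube_self r t x) (hxd t) (k + 1) htk hnb hap
    refine ⟨⟨(t, didx r t x), htop, hroot⟩, ?_, ?_, z', hz', hd.trans (by gcongr)⟩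
    · refine (hf.dist_le_mul _ _).trans ?_
      simp only
      gcongr
      rw [dist_eq_norm]
      exact (dcube_norm_lt r hr t (didx r t x) _ _ (dcube_self r t x) (hx0 _ _ htop)).le
    · refine hk3.trans ?_
      simp only
      gcongr
      norm_num

/-- Coordinates on a Lipschitz graph. -/
lemma graph_param (n : ℕ) : ∃ D : ℝ≥0, 1 ≤ D ∧ ∀ Γ : Set (Euc n), IsLipschitzGraph n 1 Γ →
    ∃ G : (Fin n → ℝ) → Euc n, ∃ h : Euc n → (Fin n → ℝ), LipschitzWith D G ∧ LipschitzWith 1 h ∧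
      (∀ v, h (G v) = v) ∧ range G = Γ := by
  refine ⟨(1 + 1) * (1 * (Fintype.card (Fin n) : ℝ≥0) ^ (1 / (2 : ℝ≥0∞)).toReal) + 1, le_add_of_nonneg_left (by positivity), ?_⟩
  rintro Γ ⟨P, hP, ρ, hρ, rfl⟩
  let e : P ≃ₗᵢ[ℝ] EuclideanSpace ℝ (Fin n) := ((stdOrthonormalBasis ℝ P).reindex (finCongr hP)).repr
  have hπ : LipschitzWith 1 (fun y : Euc n => P.orthogonalProjectionOnto y) := by
    apply LipschitzWith.of_dist_le_mul
    intro a b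
    rw [dist_eq_norm, dist_eq_norm, ← map_sub, NNReal.coe_one, one_mul]
    exact Submodule.norm_orthogonalProjectionOnto_apply_le _ _
  have hγ : LipschitzWith (1 + 1) (fun p : P => (p : Euc n) + ((ρ p : Pᗮ) : Euc n)) := by
    apply LipschitzWith.add
    · exact LipschitzWith.subtype_val _
    · have := (LipschitzWith.subtype_val (Pᗮ : Set (Euc n))).comp hρ
      exact this.weaken (by simp)
  have hψ : LipschitzWith (1 * (Fintype.card (Fin n) : ℝ≥0) ^ (1 / (2 : ℝ≥0∞)).toReal)
      (fun v : Fin n → ℝ => e.symm (WithLp.toLp 2 v)) :=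
    e.symm.lipschitz.comp (PiLp.lipschitzWith_toLp 2 (fun _ : Fin n => ℝ))
  refine ⟨fun v => ((e.symm (WithLp.toLp 2 v) : P) : Euc n) + ((ρ (e.symm (WithLp.toLp 2 v)) : Pᗮ) : Euc n),
    fun y => WithLp.ofLp (e (P.orthogonalProjectionOnto y)), ?_, ?_, ?_, ?_⟩
  · exact (hγ.comp hψ).weaken (le_add_of_nonneg_right zero_le_one)
  · have h1 := (PiLp.lipschitzWith_ofLp 2 (fun _ : Fin n => ℝ)).comp (e.lipschitz.comp hπ)
    exact h1.weaken (by simp)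
  · intro v
    set p := e.symm (WithLp.toLp 2 v) with hp
    have : P.orthogonalProjectionOnto ((p : Euc n) + ((ρ p : Pᗮ) : Euc n)) = p := by
      rw [map_add, Submodule.orthogonalProjectionOnto_mem_subspace_eq_self]
      have : P.orthogonalProjectionOnto ((ρ p : Pᗮ) : Euc n) = 0 := by
        rw [Submodule.orthogonalProjectionOnto_eq_zero_iff]; exact (ρ p).2
      rw [this, add_zero]
    change WithLp.ofLp (e (P.orthogonalProjectionOnto ((p : Euc n) + ((ρ p : Pᗮ) : Euc n)))) = v
    rw [this, hp]; simp
  · ext y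
    constructor
    · rintro ⟨v, rfl⟩; exact ⟨_, rfl⟩
    · rintro ⟨p, rfl⟩; exact ⟨WithLp.ofLp (e p), by simp⟩

lemma hmeas_ball (n : ℕ) (q : Fin n → ℝ) (t : ℝ) (ht : 0 < t) :
    μH[(n : ℝ)] (ball q t) = ENNReal.ofReal ((2 * t) ^ n) := by
  have h := hausdorffMeasure_pi_real (ι := Fin n)
  rw [Fintype.card_fin] at h
  rw [h, Real.volume_pi_ball q ht, Fintype.card_fin]

lemma graph_pieces (n : ℕ) : ∃ (c C D : ℝ), 0 < c ∧ 0 ≤ C ∧ 1 ≤ D ∧ ∀ Γ : Set (Euc n), IsLipschitzGraph n 1 Γ →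
    (∀ y s, 0 < s → μH[(n : ℝ)] (Γ ∩ ball y s) ≤ ENNReal.ofReal (C * s ^ n)) ∧
    ∀ z ∈ Γ, ∀ b : ℝ, 0 < b → ∃ A : Set (Euc n), A ⊆ Γ ∧ IsCompact A ∧ Γ ∩ closedBall z b ⊆ A ∧
      A ⊆ closedBall z (D * b) ∧
      ∀ y ∈ A, ∀ s, 0 < s → s ≤ b → ENNReal.ofReal (c * s ^ n) ≤ μH[(n : ℝ)] (A ∩ ball y s) := by
  obtain ⟨D, hD1, hD⟩ := graph_param n
  have hD1' : (1 : ℝ) ≤ D := by exact_mod_cast hD1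
  have hD0 : (0 : ℝ) < D := by linarith
  refine ⟨(2 * (1 / (4 * D))) ^ n, D ^ n * 2 ^ n, D, by positivity, by positivity, hD1', ?_⟩
  intro Γ hΓ
  obtain ⟨G, h, hG, hh, hhG, rfl⟩ := hD Γ hΓ
  refine ⟨?_, ?_⟩
  · intro y s hs
    have hsub : range G ∩ ball y s ⊆ G '' ball (h y) s := by
      rintro _ ⟨⟨v, rfl⟩, hv⟩
      refine ⟨v, ?_, rfl⟩
      have := hh.dist_le_mul (G v) y
      rw [hhG, NNReal.coe_one, one_mul] at this
      exact lt_of_le_of_lt this hv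
    refine (measure_mono hsub).trans ((hG.hausdorffMeasure_image_le (by positivity) _).trans ?_)
    rw [hmeas_ball n _ s hs, mul_assoc, ENNReal.ofReal_mul (p := (D : ℝ) ^ n) (by positivity), ← mul_pow]
    gcongr
    rw [ENNReal.rpow_natCast, ← ENNReal.ofReal_coe_nnreal, ENNReal.ofReal_pow (by positivity)]
  · intro z hz b hb
    refine ⟨G '' closedBall (h z) b, image_subset_range _ _, (isCompact_closedBall _ _).image hG.continuous, ?_, ?_, ?_⟩
    · rintro _ ⟨⟨v, rfl⟩, hv⟩
      refine ⟨v, ?_, rfl⟩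
      have := hh.dist_le_mul (G v) z
      rw [hhG, NNReal.coe_one, one_mul] at this
      exact this.trans hv
    · rintro _ ⟨v, hv, rfl⟩
      obtain ⟨w, rfl⟩ := hz
      rw [hhG] at hv
      refine (hG.dist_le_mul _ _).trans ?_
      gcongr
      exact hv
    · rintro _ ⟨v, hv, rfl⟩ s hs hsb
      set t : ℝ := s / (4 * D) with ht
      have ht0 : 0 < t := by positivity
      have htD : t * (4 * D) = s := by rw [ht]; field_simp
      have htb : t ≤ b := by nlinarith
      have hb1 : t / b ≤ 1 := (div_le_one hb).mpr htb
      set q : Fin n → ℝ := v + (t / b) • (h z - v) with hq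
      have hv' : ‖h z - v‖ ≤ b := by rw [← dist_eq_norm, dist_comm]; exact hv
      have hqv : dist q v ≤ t := by
        rw [dist_eq_norm, hq, add_sub_cancel_left, norm_smul, Real.norm_of_nonneg (by positivity)]
        calc t / b * ‖h z - v‖ ≤ t / b * b := by gcongr
          _ = t := by field_simp
      have hqz : dist q (h z) ≤ b - t := by
        have : q - h z = -((1 - t / b) • (h z - v)) := by rw [hq, sub_smul, one_smul]; abel
        rw [dist_eq_norm, this, norm_neg, norm_smul, Real.norm_of_nonneg (by linarith)]
        calc (1 - t / b) * ‖h z - v‖ ≤ (1 - t / b) * b := by gcongr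
          _ = b - t := by field_simp
      have hsub : G '' ball q t ⊆ G '' closedBall (h z) b ∩ ball (G v) s := by
        rintro _ ⟨w, hw, rfl⟩
        have hw' : dist w q < t := hw
        refine ⟨⟨w, ?_, rfl⟩, ?_⟩
        · have := dist_triangle w q (h z)
          rw [mem_closedBall]; linarith
        · rw [mem_ball]
          have h1 := hG.dist_le_mul w v
          have h2 := dist_triangle w q v
          have h3 : (D : ℝ) * dist w v ≤ D * (2 * t) := by gcongr; linarith
          nlinarith
      have himg : ball q t = h '' (G '' ball q t) := by
        rw [← image_comp]
        have : h ∘ G = id := funext hhG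
        rw [this, image_id]
      have e1 := hh.hausdorffMeasure_image_le (d := (n : ℝ)) (by positivity) (G '' ball q t)
      rw [← himg, hmeas_ball n q t ht0] at e1
      simp only [ENNReal.coe_one, ENNReal.one_rpow, one_mul] at e1
      refine le_trans (le_of_eq ?_) (e1.trans (measure_mono hsub))
      congr 1
      rw [← mul_pow]; congr 1; rw [ht]; field_simp

/-- A configuration of graph pieces attached to a closed set `K`. -/
structure Conf (n : ℕ) (E K : Set (Euc n)) {ι : Type} (l : ι → ℝ) (z y : ι → Euc n) (Γ A : ι → Set (Euc n))
    (r CE M R c Cg B : ℝ) (N : ℕ) : Prop where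
  hM : 1 ≤ M
  hR : 1 ≤ R
  hr : 0 < r
  hCE : 1 ≤ CE
  hc : 0 < c
  hCg : 0 ≤ Cg
  hKc : IsClosed K
  hKE : K ⊆ E
  hup : ∀ w ∈ E, ∀ s : ℝ, 0 < s → s ≤ B * r → μH[(n : ℝ)] (E ∩ ball w s) ≤ ENNReal.ofReal (CE * s ^ n)
  hlo : ∀ w ∈ E, ∀ s : ℝ, 0 < s → s ≤ B * r → ENNReal.ofReal (CE⁻¹ * s ^ n) ≤ μH[(n : ℝ)] (E ∩ ball w s)
  hl0 : ∀ T, 0 < l T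
  hlr : ∀ T, l T ≤ r
  hΓ : ∀ T, IsLipschitzGraph n 1 (Γ T)
  hAΓ : ∀ T, A T ⊆ Γ T
  hAc : ∀ T, IsCompact (A T)
  hAb : ∀ T, Γ T ∩ closedBall (z T) (3 * M * l T) ⊆ A T
  hA2 : ∀ T, A T ⊆ closedBall (z T) (R * l T)
  hAlow : ∀ T, ∀ w ∈ A T, ∀ s, 0 < s → s ≤ 3 * M * l T → ENNReal.ofReal (c * s ^ n) ≤ μH[(n : ℝ)] (A T ∩ ball w s)
  hAup : ∀ T w s, 0 < s → μH[(n : ℝ)] (Γ T ∩ ball w s) ≤ ENNReal.ofReal (Cg * s ^ n)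
  hyK : ∀ T, y T ∈ K
  hyz : ∀ T, dist (y T) (z T) ≤ M * l T
  hN : ∀ w ∈ K, ∀ τ : Finset ι, (∀ T ∈ τ, dist w (z T) < (2 * (2 * R + M + 1) + M + 1) * l T) → τ.card ≤ N
  hP : ∀ w ∈ K, ∀ s : ℝ, 0 < s → s ≤ r → ∃ T, dist w (z T) ≤ M * l T ∧ s ≤ 2 * l T ∧ ∃ z' ∈ Γ T, dist w z' ≤ M * s

namespace Conf
variable {n : ℕ} {E K : Set (Euc n)} {ι : Type} {l : ι → ℝ} {z y : ι → Euc n} {Γ A : ι → Set (Euc n)}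
    {r CE M R c Cg B : ℝ} {N : ℕ}

lemma count (H : Conf n E K l z y Γ A r CE M R c Cg B N) (w : Euc n) (τ : Finset ι)
    (hτ : ∀ T ∈ τ, dist w (z T) ≤ (2 * R + M + 1) * l T) : τ.card ≤ N := by
  rcases τ.eq_empty_or_nonempty with rfl | hne
  · simp
  obtain ⟨T0, hT0, hmin⟩ := τ.exists_min_image l hne
  apply H.hN (y T0) (H.hyK T0)
  intro T hT
  have h1 := hmin T hT
  have h2 := hτ T hT
  have h3 := hτ T0 hT0
  have h4 := H.hyz T0
  have h5 := dist_triangle (y T0) (z T0) (z T)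
  have h6 := dist_triangle_left (z T0) (z T) w
  have hM := H.hM
  have hR := H.hR
  have h7 : M * l T0 ≤ M * l T := by gcongr
  have h8 : (2 * R + M + 1) * l T0 ≤ (2 * R + M + 1) * l T := by gcongr
  have := H.hl0 T
  nlinarith

lemma count_finite (H : Conf n E K l z y Γ A r CE M R c Cg B N) (w : Euc n) :
    {T | dist w (z T) ≤ (2 * R + M + 1) * l T}.Finite := by
  by_contra hinf
  obtain ⟨τ, hτ, hcard⟩ := Set.Infinite.exists_subset_card_eq hinf (N + 1)
  have := H.count w τ (fun T hT => hτ hT)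
  omega

lemma closed (H : Conf n E K l z y Γ A r CE M R c Cg B N) : IsClosed (K ∪ ⋃ T, A T) := by
  have hM := H.hM
  have hR := H.hR
  rw [← isOpen_compl_iff, Metric.isOpen_iff]
  intro w hw
  rw [mem_compl_iff, mem_union, not_or] at hw
  obtain ⟨hwK, hwA⟩ := hw
  obtain ⟨d, hd, hdK⟩ := Metric.isOpen_iff.mp H.hKc.isOpen_compl w hwK
  have hfin := H.count_finite w
  have hcl : IsClosed (⋃ T ∈ {T | dist w (z T) ≤ (2 * R + M + 1) * l T}, A T) :=
    hfin.isClosed_biUnion fun T _ => (H.hAc T).isClosed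
  have hwn : w ∈ (⋃ T ∈ {T | dist w (z T) ≤ (2 * R + M + 1) * l T}, A T)ᶜ := by
    intro hmem
    obtain ⟨T, _, hT⟩ := mem_iUnion₂.mp hmem
    exact hwA (mem_iUnion.mpr ⟨T, hT⟩)
  obtain ⟨e, he, heA⟩ := Metric.isOpen_iff.mp hcl.isOpen_compl w hwn
  refine ⟨min (d / 2) e, by positivity, ?_⟩
  intro v hv
  rw [mem_ball, lt_min_iff] at hv
  rw [mem_compl_iff, mem_union, not_or]
  constructor
  · have : v ∈ ball w d := by rw [mem_ball]; linarith
    exact hdK this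
  · intro hvA
    obtain ⟨T, hT⟩ := mem_iUnion.mp hvA
    have hve : v ∈ ball w e := hv.2
    apply heA hve
    refine mem_iUnion₂.mpr ⟨T, ?_, hT⟩
    have h1 : dist v (z T) ≤ R * l T := H.hA2 T hT
    have h2 := H.hyz T
    have h3 : d ≤ dist (y T) w := by
      by_contra hcon
      push Not at hcon
      exact hdK (mem_ball.mpr hcon) (H.hyK T)
    have h4 := dist_triangle (y T) (z T) w
    have h5 := dist_triangle (z T) v w
    have h6 := dist_triangle w v (z T)
    rw [dist_comm w v] at h6
    rw [dist_comm (z T) v] at h5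
    have := H.hl0 T
    rw [mem_ofPred_eq]
    nlinarith [hv.1]

lemma lower_K (H : Conf n E K l z y Γ A r CE M R c Cg B N) (B2 : ℝ) (hB2 : 4 * M ≤ B2) (w : Euc n) (hw : w ∈ K)
    (s : ℝ) (hs : 0 < s) (hsr : s ≤ B2 * r) :
    ∃ T, ENNReal.ofReal (c * (s / (2 * B2)) ^ n) ≤ μH[(n : ℝ)] (ball w s ∩ (K ∪ ⋃ T, A T) ∩ Γ T) := by
  have hM := H.hM
  have hB0 : 0 < B2 := by linarith
  have hs' : s / B2 ≤ r := by rw [div_le_iff₀ hB0]; linarith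
  obtain ⟨T, h1, h2, z', hz', h3⟩ := H.hP w hw (s / B2) (by positivity) hs'
  have hl := H.hl0 T
  have hzA : z' ∈ A T := by
    apply H.hAb T
    refine ⟨hz', ?_⟩
    rw [mem_closedBall]
    have h4 := dist_triangle_left z' (z T) w
    have h5 : M * (s / B2) ≤ M * (2 * l T) := by gcongr
    nlinarith
  have ht : s / (2 * B2) = s / B2 / 2 := by field_simp
  have h4 := H.hAlow T z' hzA (s / (2 * B2)) (by positivity) (by rw [ht]; nlinarith)
  refine ⟨T, h4.trans (measure_mono ?_)⟩
  rintro v ⟨hvA, hv⟩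
  refine ⟨⟨?_, Or.inr (mem_iUnion.mpr ⟨T, hvA⟩)⟩, H.hAΓ T hvA⟩
  rw [mem_ball] at hv ⊢
  have h5 := dist_triangle v z' w
  rw [dist_comm z' w] at h5
  have h6 : M * (s / B2) ≤ s / 4 := by
    rw [mul_div_assoc', div_le_div_iff₀ hB0 (by norm_num)]; nlinarith
  have h7 : s / (2 * B2) ≤ s / 2 := by
    apply div_le_div_of_nonneg_left hs.le (by norm_num); linarith
  linarith

lemma lower (H : Conf n E K l z y Γ A r CE M R c Cg B N) (B2 : ℝ) (hB2 : 4 * M + R ≤ B2) (w : Euc n)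
    (hw : w ∈ K ∪ ⋃ T, A T) (s : ℝ) (hs : 0 < s) (hsr : s ≤ B2 * r) :
    ∃ T, ENNReal.ofReal (c * (1 / (4 * B2)) ^ n * s ^ n) ≤ μH[(n : ℝ)] (ball w s ∩ (K ∪ ⋃ T, A T) ∩ Γ T) := by
  have hM := H.hM
  have hR := H.hR
  have hc := H.hc
  have hB0 : 0 < B2 := by linarith
  have e : ∀ b : ℝ, 0 < b → b ≤ 4 * B2 → c * (1 / (4 * B2)) ^ n * s ^ n ≤ c * (s / b) ^ n := by
    intro b hb hbb
    rw [mul_assoc, ← mul_pow, one_div_mul_eq_div]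
    gcongr
  rcases hw with hw | hw
  · obtain ⟨T, hT⟩ := H.lower_K B2 (by linarith) w hw s hs hsr
    exact ⟨T, le_trans (ENNReal.ofReal_le_ofReal (e _ (by positivity) (by linarith))) hT⟩
  · obtain ⟨T, hT⟩ := mem_iUnion.mp hw
    have hl := H.hl0 T
    by_cases hsl : s ≤ 2 * (R + M) * l T
    · have h4 := H.hAlow T w hT (s / (2 * (R + M))) (by positivity) (by
        rw [div_le_iff₀ (by positivity)]
        nlinarith [mul_pos (by linarith : 0 < R + M) hl])
      refine ⟨T, le_trans (ENNReal.ofReal_le_ofReal (e _ (by positivity) (by linarith))) (h4.trans (measure_mono ?_))⟩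
      rintro v ⟨hvA, hv⟩
      refine ⟨⟨?_, Or.inr (mem_iUnion.mpr ⟨T, hvA⟩)⟩, H.hAΓ T hvA⟩
      rw [mem_ball] at hv ⊢
      exact lt_of_lt_of_le hv (div_le_self hs.le (by linarith))
    · push Not at hsl
      obtain ⟨T', hT'⟩ := H.lower_K B2 (by linarith) (y T) (H.hyK T) (s / 2) (by positivity) (by linarith)
      refine ⟨T', le_trans (ENNReal.ofReal_le_ofReal ?_) (hT'.trans (measure_mono ?_))⟩
      · rw [div_div]
        exact e _ (by positivity) (by linarith)
      · gcongr
        intro v hv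
        rw [mem_ball] at hv ⊢
        have h1 : dist w (z T) ≤ R * l T := H.hA2 T hT
        have h2 := H.hyz T
        have h3 := dist_triangle v (y T) w
        have h4 := dist_triangle_right (y T) w (z T)
        linarith
end Conf

lemma tsum_indicator_card {ι X : Type*} (b : ι → Set X) (N : ℕ) (x : X)
    (h : ∀ τ : Finset ι, (∀ T ∈ τ, x ∈ b T) → τ.card ≤ N) :
    ∑' T, (b T).indicator (1 : X → ℝ≥0∞) x ≤ N := by
  classical
  rw [ENNReal.tsum_eq_iSup_sum]
  apply iSup_le
  intro σ
  have h1 : ∑ T ∈ σ, (b T).indicator (1 : X → ℝ≥0∞) x = ((σ.filter (fun T => x ∈ b T)).card : ℝ≥0∞) := by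
    rw [Finset.card_filter]
    push_cast
    apply Finset.sum_congr rfl
    intro T _
    by_cases hT : x ∈ b T <;> simp [hT]
  rw [h1]
  have := h (σ.filter (fun T => x ∈ b T)) (fun T hT => (Finset.mem_filter.mp hT).2)
  exact_mod_cast this

lemma sum_balls_le {ι X : Type*} [Countable ι] [MeasurableSpace X] (ν : Measure X) (b : ι → Set X)
    (hb : ∀ T, MeasurableSet (b T)) (N : ℕ)
    (h : ∀ x, ∀ τ : Finset ι, (∀ T ∈ τ, x ∈ b T) → τ.card ≤ N) : ∑' T, ν (b T) ≤ N * ν univ := by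
  calc ∑' T, ν (b T) = ∑' T, ∫⁻ x, (b T).indicator (1 : X → ℝ≥0∞) x ∂ν := by
        congr 1; ext T; rw [lintegral_indicator_one (hb T)]
    _ = ∫⁻ x, ∑' T, (b T).indicator (1 : X → ℝ≥0∞) x ∂ν := by
        rw [lintegral_tsum]
        intro T
        exact (measurable_one.indicator (hb T)).aemeasurable
    _ ≤ ∫⁻ _, (N : ℝ≥0∞) ∂ν := lintegral_mono fun x => tsum_indicator_card b N x (h x)
    _ = _ := lintegral_const _

namespace Conf
variable {n : ℕ} {E K : Set (Euc n)} {ι : Type} {l : ι → ℝ} {z y : ι → Euc n} {Γ A : ι → Set (Euc n)}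
    {r CE M R c Cg B : ℝ} {N : ℕ}

lemma small_sum [Countable ι] (H : Conf n E K l z y Γ A r CE M R c Cg B N) (hB : 1 ≤ B) (τ : Set ι) (X : Set (Euc n))
    (hX : ∀ T ∈ τ, ball (y T) (l T) ⊆ X) :
    ∑' T : τ, ENNReal.ofReal (l T ^ n) ≤ ENNReal.ofReal CE * (N * μH[(n : ℝ)] (E ∩ X)) := by
  have hCE := H.hCE
  have hM := H.hM
  have hR := H.hR
  have h1 : ∀ T : τ, ENNReal.ofReal (l T ^ n) ≤
      ENNReal.ofReal CE * (μH[(n : ℝ)]).restrict (E ∩ X) (ball (y T) (l T)) := by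
    intro T
    have hl := H.hl0 T
    have hlr := H.hlr T
    rw [Measure.restrict_apply measurableSet_ball]
    have e1 : ball (y T) (l T) ∩ (E ∩ X) = E ∩ ball (y T) (l T) := by
      have := hX T T.2
      ext v; constructor
      · rintro ⟨a, b, _⟩; exact ⟨b, a⟩
      · rintro ⟨a, b⟩; exact ⟨b, a, this b⟩
    rw [e1]
    have h2 := H.hlo (y T) (H.hKE (H.hyK T)) (l T) hl (by nlinarith [H.hr])
    calc ENNReal.ofReal (l T ^ n) = ENNReal.ofReal CE * ENNReal.ofReal (CE⁻¹ * l T ^ n) := by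
          rw [← ENNReal.ofReal_mul (by linarith), mul_inv_cancel_left₀ (by linarith)]
      _ ≤ _ := by gcongr
  refine (ENNReal.tsum_le_tsum h1).trans ?_
  rw [ENNReal.tsum_mul_left]
  gcongr
  refine (sum_balls_le _ (fun T : τ => ball (y T) (l T)) (fun T => measurableSet_ball) N ?_).trans (le_of_eq (by simp))
  intro x σ hσ
  rw [← Finset.card_map (Function.Embedding.subtype _)]
  apply H.count x
  intro T hT
  obtain ⟨T', hT', rfl⟩ := Finset.mem_map.mp hT
  have h3 : dist x (y T') < l T' := hσ T' hT'
  have h4 := H.hyz T'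
  have h5 := dist_triangle x (y T') (z T')
  have hl := H.hl0 T'
  simp only [Function.Embedding.subtype_apply]
  nlinarith

lemma upper [Countable ι] (H : Conf n E K l z y Γ A r CE M R c Cg B N) (w : Euc n) (s : ℝ) (hs : 0 < s)
    (hsB : 2 * (R + M + 2) * s ≤ B * r) (hB : 1 ≤ B) :
    μH[(n : ℝ)] ((K ∪ ⋃ T, A T) ∩ ball w s) ≤
      ENNReal.ofReal ((CE * 2 ^ n + N * Cg + Cg * (2 * R) ^ n * CE * N * (CE * (2 * (R + M + 2)) ^ n)) * s ^ n) := by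
  have hCE := H.hCE
  have hM := H.hM
  have hR := H.hR
  have hCg := H.hCg
  have hr := H.hr
  -- the three pieces
  set τ1 : Set ι := {T | dist w (z T) ≤ (2 * R + M + 1) * l T} with hτ1
  set τ2 : Set ι := {T | ball (y T) (l T) ⊆ ball w ((R + M + 2) * s)} with hτ2
  have hfin : τ1.Finite := H.count_finite w
  have hcard : hfin.toFinset.card ≤ N := H.count w _ (fun T hT => by simpa [hτ1] using hT)
  have hsub : (K ∪ ⋃ T, A T) ∩ ball w s ⊆ (K ∩ ball w s) ∪ ((⋃ T ∈ hfin.toFinset, Γ T ∩ ball w s) ∪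
      ⋃ T : τ2, A T) := by
    rintro v ⟨hv | hv, hvs⟩
    · exact Or.inl ⟨hv, hvs⟩
    · right
      obtain ⟨T, hT⟩ := mem_iUnion.mp hv
      have hl := H.hl0 T
      have h1 : dist v (z T) ≤ R * l T := H.hA2 T hT
      have h2 := H.hyz T
      have h3 : dist v w < s := hvs
      by_cases hls : s ≤ l T
      · left
        refine mem_iUnion₂.mpr ⟨T, ?_, H.hAΓ T hT, hvs⟩
        rw [Set.Finite.mem_toFinset, hτ1, mem_ofPred_eq]
        have := dist_triangle_left w (z T) v
        nlinarith
      · right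
        push Not at hls
        refine mem_iUnion.mpr ⟨⟨T, ?_⟩, hT⟩
        rw [hτ2, mem_ofPred_eq]
        intro u hu
        rw [mem_ball] at hu ⊢
        have a1 := dist_triangle u (y T) w
        have a2 := dist_triangle (y T) (z T) w
        have a3 := dist_triangle_left (z T) w v
        have a4 : R * l T ≤ R * s := by gcongr
        have a5 : M * l T ≤ M * s := by gcongr
        linarith
  have hK : μH[(n : ℝ)] (K ∩ ball w s) ≤ ENNReal.ofReal (CE * 2 ^ n * s ^ n) := by
    rcases (K ∩ ball w s).eq_empty_or_nonempty with h0 | ⟨v, hvK, hv⟩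
    · rw [h0]; simp
    · have h1 := H.hup v (H.hKE hvK) (2 * s) (by positivity) (by nlinarith)
      rw [mul_pow, ← mul_assoc] at h1
      refine le_trans (measure_mono ?_) h1
      rintro u ⟨huK, hu⟩
      refine ⟨H.hKE huK, ?_⟩
      rw [mem_ball] at hu hv ⊢
      have := dist_triangle_right u v w
      linarith
  have h1 : μH[(n : ℝ)] (⋃ T ∈ hfin.toFinset, Γ T ∩ ball w s) ≤ ENNReal.ofReal (N * Cg * s ^ n) := by
    refine (measure_biUnion_finset_le _ _).trans ?_
    refine (Finset.sum_le_sum (fun T _ => H.hAup T w s hs)).trans ?_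
    rw [Finset.sum_const, nsmul_eq_mul, mul_assoc, ENNReal.ofReal_mul (p := (N : ℝ)) (by positivity), ENNReal.ofReal_natCast]
    gcongr
  have h2 : μH[(n : ℝ)] (⋃ T : τ2, A T) ≤
      ENNReal.ofReal (Cg * (2 * R) ^ n * CE * N * (CE * (2 * (R + M + 2)) ^ n) * s ^ n) := by
    refine (measure_iUnion_le _).trans ?_
    have a1 : ∀ T : τ2, μH[(n : ℝ)] (A T) ≤ ENNReal.ofReal (Cg * (2 * R) ^ n) * ENNReal.ofReal (l T ^ n) := by
      intro T
      have hl := H.hl0 T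
      rw [← ENNReal.ofReal_mul (by positivity), mul_assoc, ← mul_pow]
      refine le_trans (measure_mono ?_) (H.hAup T (z T) (2 * R * l T) (by positivity))
      intro v hv
      refine ⟨H.hAΓ T hv, ?_⟩
      have : dist v (z T) ≤ R * l T := H.hA2 T hv
      rw [mem_ball]; nlinarith
    refine (ENNReal.tsum_le_tsum a1).trans ?_
    rw [ENNReal.tsum_mul_left]
    have a2 := H.small_sum hB τ2 (ball w ((R + M + 2) * s)) (fun T hT => hT)
    have a3 : μH[(n : ℝ)] (E ∩ ball w ((R + M + 2) * s)) ≤ ENNReal.ofReal (CE * (2 * (R + M + 2)) ^ n * s ^ n) := by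
      rcases (E ∩ ball w ((R + M + 2) * s)).eq_empty_or_nonempty with h0 | ⟨v, hvE, hv⟩
      · rw [h0]; simp
      · have h1 := H.hup v hvE (2 * (R + M + 2) * s) (by positivity) hsB
        rw [mul_pow, ← mul_assoc] at h1
        refine le_trans (measure_mono ?_) h1
        rintro u ⟨huK, hu⟩
        refine ⟨huK, ?_⟩
        rw [mem_ball] at hu hv ⊢
        have := dist_triangle_right u v w
        linarith
    calc _ ≤ ENNReal.ofReal (Cg * (2 * R) ^ n) * (ENNReal.ofReal CE * (N * ENNReal.ofReal (CE * (2 * (R + M + 2)) ^ n * s ^ n))) := by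
          gcongr
          exact a2.trans (by gcongr)
      _ = _ := by
          rw [← ENNReal.ofReal_natCast, ← ENNReal.ofReal_mul (by positivity), ← ENNReal.ofReal_mul (by positivity),
            ← ENNReal.ofReal_mul (by positivity)]
          congr 1; ring
  refine (measure_mono hsub).trans ((measure_union_le _ _).trans ?_)
  refine (add_le_add hK ((measure_union_le _ _).trans (add_le_add h1 h2))).trans (le_of_eq ?_)
  rw [← ENNReal.ofReal_add (by positivity) (by positivity), ← ENNReal.ofReal_add (by positivity) (by positivity)]
  congr 1; ring

/-- The union of a configuration is ADR with big pieces of Lipschitz graphs. -/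
lemma final [Countable ι] (H : Conf n E K l z y Γ A r CE M R c Cg B N) (x0 : Euc n) (hx0 : K ⊆ closedBall x0 r)
    (B2 θ₂ C₁ : ℝ) (hB2 : B2 = 4 * (M + R + 1)) (hB : B = 2 * (R + M + 2) * B2)
    (hθ : θ₂ = c * (1 / (4 * B2)) ^ n)
    (hC : C₁ = 1 + θ₂⁻¹ + (CE * 2 ^ n + N * Cg + Cg * (2 * R) ^ n * CE * N * (CE * (2 * (R + M + 2)) ^ n))) :
    IsADR n (K ∪ ⋃ T, A T) C₁ ∧ HasBPLG n (K ∪ ⋃ T, A T) θ₂ 1 := by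
  have hCE := H.hCE
  have hM := H.hM
  have hR := H.hR
  have hCg := H.hCg
  have hr := H.hr
  have hc := H.hc
  have hB20 : 0 < B2 := by rw [hB2]; positivity
  have hθ0 : 0 < θ₂ := by rw [hθ]; positivity
  have hdiam : ∀ s : ℝ, ENNReal.ofReal s < EMetric.diam (K ∪ ⋃ T, A T) → s ≤ B2 * r := by
    intro s hs
    have hsub : (K ∪ ⋃ T, A T) ⊆ closedBall x0 ((1 + M + R) * r) := by
      rintro v (hv | hv)
      · have := hx0 hv
        rw [mem_closedBall] at this ⊢
        nlinarith
      · obtain ⟨T, hT⟩ := mem_iUnion.mp hv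
        have h1 : dist v (z T) ≤ R * l T := H.hA2 T hT
        have h2 := H.hyz T
        have h3 : dist (y T) x0 ≤ r := hx0 (H.hyK T)
        have h4 := dist_triangle v (z T) x0
        have h5 := dist_triangle_left (z T) x0 (y T)
        have h6 : R * l T ≤ R * r := by gcongr; exact H.hlr T
        have h7 : M * l T ≤ M * r := by gcongr; exact H.hlr T
        rw [mem_closedBall]; linarith
    by_contra hcon
    push Not at hcon
    have h1 : EMetric.diam (K ∪ ⋃ T, A T) ≤ ENNReal.ofReal s := by
      apply EMetric.diam_le
      intro a ha b hb
      rw [edist_dist]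
      apply ENNReal.ofReal_le_ofReal
      have ha' := hsub ha
      have hb' := hsub hb
      rw [mem_closedBall] at ha' hb'
      have := dist_triangle_right a b x0
      rw [hB2] at hcon
      nlinarith
    exact absurd hs (not_lt.mpr h1)
  have hlow : ∀ w ∈ K ∪ ⋃ T, A T, ∀ s : ℝ, 0 < s → ENNReal.ofReal s < EMetric.diam (K ∪ ⋃ T, A T) →
      ∃ T, ENNReal.ofReal (θ₂ * s ^ n) ≤ μH[(n : ℝ)] (ball w s ∩ (K ∪ ⋃ T, A T) ∩ Γ T) := by
    intro w hw s hs hsd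
    rw [hθ]
    exact H.lower B2 (by rw [hB2]; linarith) w hw s hs (hdiam s hsd)
  refine ⟨⟨H.closed, ?_, ?_⟩, ?_⟩
  · rw [hC]
    have : (0 : ℝ) ≤ θ₂⁻¹ + (CE * 2 ^ n + N * Cg + Cg * (2 * R) ^ n * CE * N * (CE * (2 * (R + M + 2)) ^ n)) := by positivity
    linarith
  · intro w hw s hs hsd
    constructor
    · obtain ⟨T, hT⟩ := hlow w hw s hs hsd
      refine le_trans (ENNReal.ofReal_le_ofReal ?_) (hT.trans (measure_mono ?_))
      · gcongr
        rw [inv_le_comm₀ (by rw [hC]; positivity) hθ0, hC]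
        have : (0 : ℝ) ≤ (CE * 2 ^ n + N * Cg + Cg * (2 * R) ^ n * CE * N * (CE * (2 * (R + M + 2)) ^ n)) := by positivity
        linarith
      · rintro v ⟨⟨h1, h2⟩, _⟩; exact ⟨h2, h1⟩
    · have h1 := H.upper w s hs (by
        rw [hB]
        have := hdiam s hsd
        have h2 : 2 * (R + M + 2) * s ≤ 2 * (R + M + 2) * (B2 * r) := by gcongr
        linarith) (by rw [hB, hB2]; nlinarith)
      refine h1.trans (ENNReal.ofReal_le_ofReal ?_)
      gcongr
      rw [hC]
      have : 0 < θ₂⁻¹ := by positivity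
      linarith
  · intro w hw s hs hsd
    obtain ⟨T, hT⟩ := hlow w hw s hs hsd
    exact ⟨Γ T, H.hΓ T, hT⟩
end Conf

lemma overlap_markov {n : ℕ} {ι : Type} [Countable ι] (E : Set (Euc n)) (l : ι → ℝ) (z : ι → Euc n)
    (CE Λ r C : ℝ) (hCE : 0 ≤ CE) (hΛ : 0 < Λ) (N : ℕ) (hN : 0 < N)
    (hl : ∀ T, 0 < l T) (hlr : ∀ T, l T ≤ r)
    (hsum : ∑' T, ENNReal.ofReal (l T ^ n) ≤ ENNReal.ofReal (C * r ^ n))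
    (hE : ∀ w ∈ E, ∀ s : ℝ, 0 < s → s ≤ 2 * Λ * r → μH[(n : ℝ)] (E ∩ ball w s) ≤ ENNReal.ofReal (CE * s ^ n)) :
    μH[(n : ℝ)] ({v | (N : ℝ≥0∞) ≤ ∑' T, (ball (z T) (Λ * l T)).indicator (1 : Euc n → ℝ≥0∞) v} ∩ E) ≤
      ENNReal.ofReal (CE * (2 * Λ) ^ n * (C * r ^ n) / N) := by
  have hNR : (0 : ℝ) < N := by exact_mod_cast hN
  have hmeas : Measurable fun v => ∑' T, (ball (z T) (Λ * l T)).indicator (1 : Euc n → ℝ≥0∞) v := by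
    apply Measurable.ennreal_tsum
    intro T
    exact measurable_one.indicator measurableSet_ball
  have h1 := mul_meas_ge_le_lintegral (μ := (μH[(n : ℝ)]).restrict E) hmeas (N : ℝ≥0∞)
  rw [lintegral_tsum (fun T => (measurable_one.indicator measurableSet_ball).aemeasurable)] at h1
  have h2 : ∀ T, ∫⁻ v, (ball (z T) (Λ * l T)).indicator (1 : Euc n → ℝ≥0∞) v ∂((μH[(n : ℝ)]).restrict E) ≤
      ENNReal.ofReal (CE * (2 * Λ) ^ n) * ENNReal.ofReal (l T ^ n) := by
    intro T
    have hlT := hl T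
    rw [lintegral_indicator_one measurableSet_ball, Measure.restrict_apply measurableSet_ball]
    rcases (ball (z T) (Λ * l T) ∩ E).eq_empty_or_nonempty with h0 | ⟨v, hv, hvE⟩
    · rw [h0]; simp
    · have h3 := hE v hvE (2 * Λ * l T) (by positivity) (by gcongr; exact hlr T)
      rw [← ENNReal.ofReal_mul (by positivity), mul_assoc, ← mul_pow]
      refine le_trans (measure_mono ?_) h3
      rintro u ⟨hu, huE⟩
      refine ⟨huE, ?_⟩
      rw [mem_ball] at hu hv ⊢
      have := dist_triangle_right u v (z T)
      linarith
  have h4 := h1.trans ((ENNReal.tsum_le_tsum h2).trans (le_of_eq ENNReal.tsum_mul_left))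
  have h5 := h4.trans (mul_le_mul_right hsum _)
  rw [← ENNReal.ofReal_mul (by positivity)] at h5
  rw [Measure.restrict_apply (measurableSet_le measurable_const hmeas)] at h5
  rw [ENNReal.ofReal_div_of_pos hNR, ENNReal.ofReal_natCast]
  rw [ENNReal.le_div_iff_mul_le (Or.inl (by exact_mod_cast hN.ne')) (Or.inl (ENNReal.natCast_ne_top N)), mul_comm]
  exact h5

set_option maxHeartbeats 4000000 in
theorem UR_main (n : ℕ) (hn : 1 ≤ n) (CE θ : ℝ) (M₀ : ℝ≥0) :
    ∃ (θ₁ θ₂ C₁ : ℝ) (M₁ : ℝ≥0), 0 < θ₁ ∧ 0 < θ₂ ∧ 1 ≤ C₁ ∧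
      ∀ E : Set (Euc n), IsUR n E CE θ M₀ →
        ∃ 𝒮 : Set (Set (Euc n)),
          (∀ S ∈ 𝒮, IsADR n S C₁ ∧ HasBPLG n S θ₂ M₁) ∧
          ∀ x ∈ E, ∀ r : ℝ, 0 < r → ENNReal.ofReal r < EMetric.diam E →
            ∃ S ∈ 𝒮, ENNReal.ofReal (θ₁ * r ^ n) ≤ μH[(n : ℝ)] (ball x r ∩ E ∩ S) := by
  by_cases hpar : 0 < θ ∧ 1 ≤ CE
  swap
  · refine ⟨1, 1, 1, 0, by norm_num, by norm_num, le_rfl, ?_⟩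
    intro E hE
    exact absurd ⟨hE.2.1, hE.1.2.1⟩ hpar
  obtain ⟨hθ, hCE⟩ := hpar
  have hCE0 : 0 ≤ CE := by linarith
  obtain ⟨c, Cg, D, hc, hCg, hD, hgp⟩ := graph_pieces n
  set Kf : ℝ≥0 := M₀ * ((Fintype.card (Fin n) : ℝ≥0) ^ (1 / (2 : ℝ≥0∞)).toReal * 1) with hKf
  set M : ℝ := Kf + 1 with hMdef
  have hKf0 : (0 : ℝ) ≤ Kf := Kf.2
  have hM : 1 ≤ M := by rw [hMdef]; linarith
  set R : ℝ := D * (3 * M) with hRdef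
  have hR : 1 ≤ R := by rw [hRdef]; nlinarith
  set B2 : ℝ := 4 * (M + R + 1) with hB2
  set B : ℝ := 2 * (R + M + 2) * B2 with hB
  set Λ : ℝ := 2 * (2 * R + M + 1) + M + 1 with hΛ
  have hB20 : 0 < B2 := by rw [hB2]; positivity
  have hB0 : 0 < B := by rw [hB]; positivity
  have hΛ0 : 0 < Λ := by rw [hΛ]; positivity
  set BB : ℝ := B + 2 * (n * Kf + 3) + 2 * Λ with hBB
  have hBB1 : 1 ≤ BB := by
    rw [hBB]
    have : (0 : ℝ) ≤ n * Kf := by positivity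
    linarith
  set δ : ℝ := θ / 2 ^ (n + 2) with hδ
  obtain ⟨C, hC0, hGF⟩ := good_family n hn Kf CE δ hCE0 (by positivity)
  obtain ⟨N, hN⟩ := exists_nat_gt (CE * (2 * Λ) ^ n * (C * 2 ^ n) / (θ / 4))
  have hNR : (0 : ℝ) < N := lt_of_le_of_lt (by positivity) hN
  have hN0 : 0 < N := by exact_mod_cast hNR
  set θ₂ : ℝ := c * (1 / (4 * B2)) ^ n with hθ₂
  set C₁ : ℝ := 1 + θ₂⁻¹ + (CE * 2 ^ n + N * Cg + Cg * (2 * R) ^ n * CE * N * (CE * (2 * (R + M + 2)) ^ n)) with hC₁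
  have hθ₂0 : 0 < θ₂ := by rw [hθ₂]; positivity
  refine ⟨θ / 2 * (1 / (2 * BB)) ^ n, θ₂, C₁, 1, by positivity, hθ₂0, ?_, ?_⟩
  · rw [hC₁]
    have : (0 : ℝ) ≤ θ₂⁻¹ + (CE * 2 ^ n + N * Cg + Cg * (2 * R) ^ n * CE * N * (CE * (2 * (R + M + 2)) ^ n)) := by positivity
    linarith
  intro E hUR
  refine ⟨{S | IsADR n S C₁ ∧ HasBPLG n S θ₂ 1}, fun S hS => hS, ?_⟩
  intro x0 hx0 r0 hr0 hr0d
  obtain ⟨⟨hEc, -, hEreg⟩, -, hEur⟩ := hUR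
  set r1 : ℝ := r0 / (2 * BB) with hr1
  have hr10 : 0 < r1 := by positivity
  have hr1lt : r1 < r0 := by rw [hr1]; exact div_lt_self hr0 (by linarith)
  set r : ℝ := 2 * r1 with hr
  have hrpos : 0 < r := by positivity
  have hBr : BB * r = r0 := by rw [hr, hr1]; field_simp
  have hreg : ∀ w ∈ E, ∀ s : ℝ, 0 < s → s ≤ BB * r →
      ENNReal.ofReal (CE⁻¹ * s ^ n) ≤ μH[(n : ℝ)] (E ∩ ball w s) ∧
      μH[(n : ℝ)] (E ∩ ball w s) ≤ ENNReal.ofReal (CE * s ^ n) := by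
    intro w hw s hs hsr
    rw [hBr] at hsr
    exact hEreg w hw s hs (lt_of_le_of_lt (ENNReal.ofReal_le_ofReal hsr) hr0d)
  obtain ⟨ρ, hρ, hρm⟩ := hEur x0 hx0 r1 hr10 (lt_of_le_of_lt (ENNReal.ofReal_le_ofReal hr1lt.le) hr0d)
  set f : (Fin n → ℝ) → Euc n := fun v => ρ (WithLp.toLp 2 (v - fun _ => r1)) with hf
  have hfL : LipschitzWith Kf f :=
    hρ.comp ((PiLp.lipschitzWith_toLp 2 (fun _ : Fin n => ℝ)).comp (LipschitzWith.of_dist_le_mul (by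
      intro a b; simp)))
  have hBpos : 0 ≤ (n : ℝ) * Kf := by positivity
  obtain ⟨ι, hι, l, z, Γ, F, hl0, hlr, hΓ, hzΓ, -, hsum, hbad, hgood⟩ := hGF f hfL r hrpos E (by
    intro w hw s hs hsr
    refine (hreg w hw s hs (hsr.trans ?_)).2
    gcongr
    rw [hBB]; linarith)
  have himg : ρ '' ball 0 r1 ⊆ f '' dcube r 0 0 := by
    rintro _ ⟨u, hu, rfl⟩
    refine ⟨WithLp.ofLp u + fun _ => r1, ?_, ?_⟩
    · rw [dcube_eq_pi r hrpos, mem_univ_pi]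
      intro i
      have h1 : ‖u i‖ ≤ ‖u‖ := PiLp.norm_apply_le u i
      rw [mem_ball_zero_iff] at hu
      have h2 : |u i| < r1 := lt_of_le_of_lt h1 hu
      rw [abs_lt] at h2
      simp only [Pi.zero_apply, Int.cast_zero, pow_zero, div_one, Pi.add_apply, mem_Ico, zero_mul, zero_add, one_mul]
      constructor <;> linarith [h2.1, h2.2]
    · simp [hf]
  set g : Euc n → ℝ≥0∞ := fun v => ∑' T, (ball (z T) (Λ * l T)).indicator (1 : Euc n → ℝ≥0∞) v with hg
  have hmk := overlap_markov E l z CE Λ r C hCE0 hΛ0 N hN0 hl0 hlr hsum (by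
    intro w hw s hs hsr
    refine (hreg w hw s hs (hsr.trans ?_)).2
    gcongr
    rw [hBB]; linarith)
  set G : Set (Euc n) := E ∩ ball x0 r1 ∩ ρ '' ball 0 r1 with hG
  set b1 : Set (Euc n) := E ∩ f '' (dcube r 0 0 \ F) with hb1
  set b2 : Set (Euc n) := {v | (N : ℝ≥0∞) ≤ g v} ∩ E with hb2
  set K0 : Set (Euc n) := G \ (b1 ∪ b2) with hK0
  have hb1m : μH[(n : ℝ)] b1 ≤ ENNReal.ofReal (θ / 4 * r1 ^ n) := by
    refine hbad.trans (ENNReal.ofReal_le_ofReal (le_of_eq ?_))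
    rw [hδ, hr, mul_pow, pow_add]; field_simp; norm_num
  have hb2m : μH[(n : ℝ)] b2 ≤ ENNReal.ofReal (θ / 4 * r1 ^ n) := by
    refine hmk.trans (ENNReal.ofReal_le_ofReal ?_)
    rw [div_lt_iff₀ (by positivity)] at hN
    rw [div_le_iff₀ hNR, hr, mul_pow 2 r1 n]
    have h0 : 0 ≤ r1 ^ n := by positivity
    have h1 := mul_le_mul_of_nonneg_right hN.le h0
    calc CE * (2 * Λ) ^ n * (C * (2 ^ n * r1 ^ n)) = CE * (2 * Λ) ^ n * (C * 2 ^ n) * r1 ^ n := by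
          simp only [mul_assoc]
      _ ≤ _ := h1
      _ = _ := by rw [mul_comm (N : ℝ), mul_right_comm]
  have hK0m : ENNReal.ofReal (θ / 2 * r1 ^ n) ≤ μH[(n : ℝ)] K0 := by
    have h1 : G ⊆ K0 ∪ (b1 ∪ b2) := by
      intro v hv
      by_cases h : v ∈ b1 ∪ b2
      · exact Or.inr h
      · exact Or.inl ⟨hv, h⟩
    have h2 := hρm.trans ((measure_mono h1).trans ((measure_union_le _ _).trans
      (add_le_add le_rfl ((measure_union_le _ _).trans (add_le_add hb1m hb2m)))))
    rw [← ENNReal.ofReal_add (by positivity) (by positivity)] at h2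
    have h3 : θ * r1 ^ n = θ / 2 * r1 ^ n + (θ / 4 * r1 ^ n + θ / 4 * r1 ^ n) := by ring
    rw [h3, ENNReal.ofReal_add (by positivity) (by positivity)] at h2
    exact (ENNReal.add_le_add_iff_right ENNReal.ofReal_ne_top).mp h2
  have hK0E : K0 ⊆ E := fun v hv => hv.1.1.1
  set K : Set (Euc n) := closure K0 with hK
  have hKE : K ⊆ E := closure_minimal hK0E hEc
  have hKball : K ⊆ closedBall x0 r1 :=
    closure_minimal (fun v hv => ball_subset_closedBall hv.1.1.2) isClosed_closedBall
  have hcount : ∀ w ∈ K, ∀ τ : Finset ι, (∀ T ∈ τ, dist w (z T) < Λ * l T) → τ.card ≤ N := by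
    intro w hw τ hτ
    have hopen : IsOpen (⋂ T ∈ τ, ball (z T) (Λ * l T)) := isOpen_biInter_finset fun T _ => isOpen_ball
    obtain ⟨v, hv, hvK⟩ := mem_closure_iff.mp hw _ hopen (mem_iInter₂.mpr fun T hT => hτ T hT)
    have hvg : g v < N := by
      by_contra hcon
      push Not at hcon
      exact hvK.2 (Or.inr ⟨hcon, hK0E hvK⟩)
    have h1 : (τ.card : ℝ≥0∞) ≤ g v := by
      calc (τ.card : ℝ≥0∞) = ∑ T ∈ τ, (1 : ℝ≥0∞) := by simp
        _ = ∑ T ∈ τ, (ball (z T) (Λ * l T)).indicator (1 : Euc n → ℝ≥0∞) v := by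
            apply Finset.sum_congr rfl
            intro T hT
            rw [indicator_of_mem (mem_iInter₂.mp hv T hT)]; rfl
        _ ≤ g v := ENNReal.sum_le_tsum τ
    exact_mod_cast (h1.trans hvg.le)
  have hP : ∀ w ∈ K, ∀ s : ℝ, 0 < s → s ≤ r →
      ∃ T, dist w (z T) ≤ M * l T ∧ s ≤ 2 * l T ∧ ∃ z' ∈ Γ T, dist w z' ≤ M * s := by
    intro w hw s hs hsr
    obtain ⟨v, hvK, hv⟩ := Metric.mem_closure_iff.mp hw (s / 2) (by positivity)
    obtain ⟨x, hxQ, hxv⟩ := himg hvK.1.2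
    have hxF : x ∈ F := by
      by_contra hcon
      exact hvK.2 (Or.inl ⟨hK0E hvK, x, ⟨hxQ, hcon⟩, hxv⟩)
    obtain ⟨T, h1, h2, z', hz', h3⟩ := (hgood x hxF).2 s hs hsr
    rw [hxv] at h1 h3
    refine ⟨T, ?_, h2, z', hz', ?_⟩
    · have := dist_triangle w v (z T)
      rw [hMdef, add_mul]; linarith
    · have := dist_triangle w v z'
      rw [hMdef, add_mul]; linarith
  -- restrict the index set
  let ι' : Type := {T : ι // ∃ v ∈ K, dist v (z T) ≤ M * l T}
  have hι' : Countable ι' := inferInstanceAs (Countable {T : ι // ∃ v ∈ K, dist v (z T) ≤ M * l T})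
  choose y hyK hyz using fun T : ι' => T.2
  choose A hAΓ hAc hAb hA2 hAlow using fun T : ι' =>
    (hgp (Γ T.1) (hΓ T.1)).2 (z T.1) (hzΓ T.1) (3 * M * l T.1) (by have := hl0 T.1; positivity)
  have H : Conf n E K (fun T : ι' => l T.1) (fun T : ι' => z T.1) y (fun T : ι' => Γ T.1) A r CE M R c Cg B N :=
    { hM := hM
      hR := hR
      hr := hrpos
      hCE := hCE
      hc := hc
      hCg := hCg
      hKc := isClosed_closure
      hKE := hKE
      hup := fun w hw s hs hsB => (hreg w hw s hs (hsB.trans (by gcongr; rw [hBB]; linarith))).2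
      hlo := fun w hw s hs hsB => (hreg w hw s hs (hsB.trans (by gcongr; rw [hBB]; linarith))).1
      hl0 := fun T => hl0 T.1
      hlr := fun T => hlr T.1
      hΓ := fun T => hΓ T.1
      hAΓ := hAΓ
      hAc := hAc
      hAb := hAb
      hA2 := fun T => (hA2 T).trans (closedBall_subset_closedBall (le_of_eq (by rw [hRdef]; ring)))
      hAlow := hAlow
      hAup := fun T => (hgp (Γ T.1) (hΓ T.1)).1
      hyK := hyK
      hyz := hyz
      hN := by
        intro w hw τ hτ
        rw [← Finset.card_map (Function.Embedding.subtype _)]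
        apply hcount w hw
        intro T hT
        obtain ⟨T', hT', rfl⟩ := Finset.mem_map.mp hT
        exact hτ T' hT'
      hP := by
        intro w hw s hs hsr
        obtain ⟨T, h1, h2, h3⟩ := hP w hw s hs hsr
        exact ⟨⟨T, w, hw, h1⟩, h1, h2, h3⟩ }
  refine ⟨K ∪ ⋃ T, A T, H.final x0 (hKball.trans (closedBall_subset_closedBall (by rw [hr]; linarith)))
    B2 θ₂ C₁ hB2 hB hθ₂ hC₁, ?_⟩
  refine le_trans (le_of_eq ?_) (hK0m.trans (measure_mono ?_))
  · congr 1
    rw [mul_assoc, ← mul_pow, hr1, one_div_mul_eq_div]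
  · intro v hv
    refine ⟨⟨?_, hK0E hv⟩, Or.inl (subset_closure hv)⟩
    exact ball_subset_ball hr1lt.le hv.1.1.2

/-- **Corollary (Azzam–Schul, co-dimension 1).** Every `n`-dimensional uniformly
rectifiable set `E ⊆ ℝ^{n+1}` (`n ≥ 1`) has big pieces of big pieces of Lipschitz
graphs: there are `θ₁ > 0` and a collection `𝒮` of `n`-dimensional ADR sets, each
having big pieces of Lipschitz graphs with uniform constants `(θ₂, M₁, C₁)`
depending only on `n` and the UR character of `E`, such that for every `x ∈ E` and
`r ∈ (0, diam E)` there is `S ∈ 𝒮` with `H^n(B(x,r) ∩ E ∩ S) ≥ θ₁ rⁿ`. -/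
theorem UR_implies_BP2LG (n : ℕ) (hn : 1 ≤ n) (CE θ : ℝ) (M₀ : ℝ≥0) :
    ∃ (θ₁ θ₂ C₁ : ℝ) (M₁ : ℝ≥0), 0 < θ₁ ∧ 0 < θ₂ ∧ 1 ≤ C₁ ∧
      ∀ E : Set (Euc n), IsUR n E CE θ M₀ →
        ∃ 𝒮 : Set (Set (Euc n)),
          (∀ S ∈ 𝒮, IsADR n S C₁ ∧ HasBPLG n S θ₂ M₁) ∧
          ∀ x ∈ E, ∀ r : ℝ, 0 < r → ENNReal.ofReal r < EMetric.diam E →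
            ∃ S ∈ 𝒮, ENNReal.ofReal (θ₁ * r ^ n) ≤ μH[(n : ℝ)] (ball x r ∩ E ∩ S) :=
  UR_main n hn CE θ M₀
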